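/- For every integer n ≥ 2 and every N ∈ ℕ, the number of minimal strict shape 1 geodesics of length N, the size of the sphere of radius N, and the number of minimal strict shape 1 geodesics of length N+3 satisfy |O_n(N)| ≤ |S_n(N)| ≤ 20·|O_n(N+3)|. -/

import Mathlib

abbrev Letter : Type := Fin 2 × Bool

def bsRels (n : ℕ) : Set (FreeGroup (Fin 2)) :=
  {FreeGroup.of 1 * FreeGroup.of 0 * (FreeGroup.of 1)⁻¹ * (FreeGroup.of 0 ^ n)⁻¹}

abbrev BS (n : ℕ) : Type := PresentedGroup (bsRels n)

def bsA (n : ℕ) : BS n := PresentedGroup.of 0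

def bsT (n : ℕ) : BS n := PresentedGroup.of 1

def evalLetter (n : ℕ) (l : Letter) : BS n :=
  cond l.2 (if l.1 = 0 then bsA n else bsT n) (if l.1 = 0 then (bsA n)⁻¹ else (bsT n)⁻¹)

def evalWord (n : ℕ) (wd : List Letter) : BS n := (wd.map (evalLetter n)).prod

noncomputable def wordLength (n : ℕ) (g : BS n) : ℕ :=
  sInf {N : ℕ | ∃ wd : List Letter, evalWord n wd = g ∧ wd.length = N}

def bsSphere (n N : ℕ) : Set (BS n) := {g : BS n | wordLength n g = N}

def sigmaD (n : ℕ) (x : ℕ →₀ ℤ) : ℤ := x.sum fun i c => c * (n : ℤ) ^ i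

def l1D (x : ℕ →₀ ℤ) : ℕ := x.sum fun _ c => c.natAbs

def kIdx (x : ℕ →₀ ℤ) : ℕ := x.support.sup id

noncomputable def wVec (n i : ℕ) : ℕ →₀ ℤ := Finsupp.single i (-(n : ℤ)) + Finsupp.single (i + 1) 1

def etaLen (u w : ℕ) (x : ℕ →₀ ℤ) : ℕ :=
  if kIdx x ≤ w ∨ u ≤ w then
    u + l1D x + kIdx x + ((w : ℤ) - kIdx x).natAbs
  else
    ((kIdx x : ℤ) - u).natAbs + l1D x + kIdx x + w

def BoxSet (n u w : ℕ) (v : ℤ) : Set (ℕ →₀ ℤ) :=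
  {x | sigmaD n x = v ∧
    (∀ i < kIdx x, |x i| ≤ ((n / 2 : ℕ) : ℤ)) ∧
    (kIdx x < max u w → |x (kIdx x)| ≤ ((n / 2 : ℕ) : ℤ)) ∧
    (max u w ≤ kIdx x → |x (kIdx x)| ≤ ((n / 2 : ℕ) : ℤ) + if n = 2 then 2 else 1)}

def absLexLE (x y : ℕ →₀ ℤ) : Prop :=
  (∀ i, |x i| = |y i|) ∨ ∃ i : ℕ, (∀ j < i, |x j| = |y j|) ∧ |x i| < |y i|

def IsMinimalVec (n u w : ℕ) (x : ℕ →₀ ℤ) : Prop :=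
  (∀ y : ℕ →₀ ℤ, sigmaD n y = sigmaD n x → etaLen u w x ≤ etaLen u w y) ∧
  (Even n → ∀ y : ℕ →₀ ℤ, sigmaD n y = sigmaD n x → etaLen u w y = etaLen u w x → absLexLE x y)

def tWord (m : ℤ) : List Letter := List.replicate m.natAbs (1, decide (0 < m))

def aWord (m : ℤ) : List Letter := List.replicate m.natAbs (0, decide (0 < m))

def eta1Word (u w : ℕ) (x : ℕ →₀ ℤ) : List Letter :=
  tWord (-(u : ℤ)) ++ aWord (x 0) ++
    (((List.range (kIdx x)).map fun j => tWord 1 ++ aWord (x (j + 1))).flatten) ++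
    tWord ((w : ℤ) - kIdx x)

def OnLang (n : ℕ) : Set (List Letter) :=
  {wd | ∃ (u w : ℕ) (x : ℕ →₀ ℤ), x ≠ 0 ∧
    x ∈ BoxSet n u w (sigmaD n x) ∧ IsMinimalVec n u w x ∧ kIdx x < w ∧
    wd = eta1Word u w x}

def DD (n : ℕ) : ℕ → ℤ → ℕ
  | 0, v => v.natAbs
  | w + 1, v => min ((v % n).natAbs + DD n w (v / n)) (((n : ℤ) - v % n).natAbs + DD n w (v / n + 1))

theorem DD_zero (n : ℕ) (v : ℤ) : DD n 0 v = v.natAbs := rfl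

theorem DD_exists0 {n : ℕ} (hn : 2 ≤ n) (w : ℕ) (v : ℤ) :
    ∃ r v' : ℤ, v = r + n * v' ∧ r.natAbs ≤ n ∧ DD n (w + 1) v = r.natAbs + DD n w v' := by
  have h1 := Int.emod_nonneg v (show (n : ℤ) ≠ 0 by omega)
  have h2 := Int.emod_lt_of_pos v (show (0 : ℤ) < n by omega)
  have h3 := Int.emod_add_mul_ediv v n
  rcases min_choice ((v % n).natAbs + DD n w (v / n))
    (((n : ℤ) - v % n).natAbs + DD n w (v / n + 1)) with h | h
  · exact ⟨v % n, v / n, h3.symm, by omega, h⟩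
  · refine ⟨v % n - n, v / n + 1, by linarith, by omega, ?_⟩
    rw [show (v % n - n : ℤ).natAbs = ((n : ℤ) - v % n).natAbs by omega]
    exact h

theorem DD_le_small {n : ℕ} (hn : 2 ≤ n) (w : ℕ) (r v' : ℤ) (hr : r.natAbs < n) :
    DD n (w + 1) (r + n * v') ≤ r.natAbs + DD n w v' := by
  have hn0 : (n : ℤ) ≠ 0 := by omega
  by_cases h : 0 ≤ r
  · have e1 : (r + n * v') % n = r := by
      rw [Int.add_mul_emod_self_left]; exact Int.emod_eq_of_lt h (by omega)
    have e2 : (r + n * v') / n = v' := by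
      rw [Int.add_mul_ediv_left _ _ hn0, Int.ediv_eq_zero_of_lt h (by omega)]; ring
    refine (min_le_left _ _).trans ?_
    rw [e1, e2]
  · have e0 : r + n * v' = (r + n) + n * (v' - 1) := by ring
    have e1 : (r + n * v') % n = r + n := by
      rw [e0, Int.add_mul_emod_self_left]; exact Int.emod_eq_of_lt (by omega) (by omega)
    have e2 : (r + n * v') / n = v' - 1 := by
      rw [e0, Int.add_mul_ediv_left _ _ hn0, Int.ediv_eq_zero_of_lt (by omega) (by omega)]; ring
    refine (min_le_right _ _).trans ?_
    rw [e1, e2]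
    simp

theorem DD_claim {n : ℕ} (hn : 2 ≤ n) (w : ℕ)
    (lip : ∀ v s : ℤ, s.natAbs ≤ 1 → DD n w (v + s) ≤ DD n w v + 1) (r v' : ℤ) :
    DD n (w + 1) (r + n * v') ≤ r.natAbs + DD n w v' := by
  induction hk : r.natAbs using Nat.strong_induction_on generalizing r v' with
  | _ k ih =>
    by_cases h : r.natAbs < n
    · rw [← hk]; exact DD_le_small hn w r v' h
    · by_cases h0 : 0 ≤ r
      · have := ih (r - n).natAbs (by omega) (r - n) (v' + 1) rfl
        rw [show r - n + n * (v' + 1) = r + n * v' by ring] at this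
        have := lip v' 1 (by simp)
        omega
      · have := ih (r + n).natAbs (by omega) (r + n) (v' + -1) rfl
        rw [show r + n + n * (v' + -1) = r + n * v' by ring] at this
        have := lip v' (-1) (by simp)
        omega

theorem DD_lip {n : ℕ} (hn : 2 ≤ n) (w : ℕ) (v s : ℤ) (hs : s.natAbs ≤ 1) :
    DD n w (v + s) ≤ DD n w v + 1 := by
  induction w generalizing v s with
  | zero => simp only [DD]; omega
  | succ w ih =>
    obtain ⟨r, v', rfl, _, e⟩ := DD_exists0 hn w v
    have := DD_claim hn w ih (r + s) v'
    rw [show r + s + n * v' = r + n * v' + s by ring] at this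
    omega

theorem DD_le {n : ℕ} (hn : 2 ≤ n) (w : ℕ) (r v' : ℤ) :
    DD n (w + 1) (r + n * v') ≤ r.natAbs + DD n w v' :=
  DD_claim hn w (fun v s h => DD_lip hn w v s h) r v'

theorem DD_exists {n : ℕ} (hn : 2 ≤ n) (w : ℕ) (v : ℤ) :
    ∃ r v' : ℤ, v = r + n * v' ∧ r.natAbs < n ∧ DD n (w + 1) v = r.natAbs + DD n w v' := by
  obtain ⟨r, v', rfl, h, e⟩ := DD_exists0 hn w v
  by_cases hr : r.natAbs < n
  · exact ⟨r, v', rfl, hr, e⟩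
  · exfalso
    by_cases h0 : 0 ≤ r
    · have h1 := DD_le hn w 0 (v' + 1)
      rw [show 0 + n * (v' + 1) = r + n * v' by have : r = n := by omega
                                                rw [this]; ring] at h1
      have := DD_lip hn w v' 1 (by simp)
      simp at h1
      omega
    · have h1 := DD_le hn w 0 (v' + -1)
      rw [show 0 + n * (v' + -1) = r + n * v' by have : r = -n := by omega
                                                 rw [this]; ring] at h1
      have := DD_lip hn w v' (-1) (by simp)
      simp at h1
      omega

theorem DD_anti_succ {n : ℕ} (hn : 2 ≤ n) (w : ℕ) (v : ℤ) : DD n (w + 1) v ≤ DD n w v := by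
  induction w generalizing v with
  | zero =>
    have := DD_le hn 0 v 0
    simpa [DD_zero] using this
  | succ w ih =>
    obtain ⟨r, v', rfl, _, e⟩ := DD_exists hn w v
    have := DD_le hn (w + 1) r v'
    have := ih v'
    omega

theorem DD_anti {n : ℕ} (hn : 2 ≤ n) {w W : ℕ} (h : w ≤ W) (v : ℤ) : DD n W v ≤ DD n w v := by
  induction h with
  | refl => exact le_rfl
  | step _ ih => exact (DD_anti_succ hn _ v).trans ih

theorem DD_le_abs {n : ℕ} (hn : 2 ≤ n) (w : ℕ) (v : ℤ) : DD n w v ≤ v.natAbs :=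
  DD_anti hn (Nat.zero_le w) v

theorem DD_shift {n : ℕ} (hn : 2 ≤ n) (w : ℕ) (v : ℤ) : DD n (w + 1) (n * v) = DD n w v := by
  apply le_antisymm
  · have := DD_le hn w 0 v
    simpa using this
  · obtain ⟨r, v', e, h, e'⟩ := DD_exists hn w (n * v)
    have hd : (n : ℤ) ∣ r := ⟨v - v', by linarith⟩
    have : r = 0 := Int.eq_zero_of_abs_lt_dvd hd (by rw [Int.abs_eq_natAbs]; exact_mod_cast h)
    subst this
    have : v = v' := by
      have : (n : ℤ) ≠ 0 := by omega
      exact mul_left_cancel₀ this (by linarith)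
    subst this
    simp at e'
    omega

theorem DD_shift_pow {n : ℕ} (hn : 2 ≤ n) (j w : ℕ) (v : ℤ) :
    DD n (w + j) ((n : ℤ) ^ j * v) = DD n w v := by
  induction j with
  | zero => simp
  | succ j ih =>
    rw [← ih, ← add_assoc, pow_succ', mul_assoc, DD_shift hn]

theorem DD_neg_le {n : ℕ} (hn : 2 ≤ n) (w : ℕ) (v : ℤ) : DD n w (-v) ≤ DD n w v := by
  induction w generalizing v with
  | zero => simp [DD_zero]
  | succ w ih =>
    obtain ⟨r, v', rfl, _, e⟩ := DD_exists hn w v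
    have := DD_le hn w (-r) (-v')
    rw [show -r + n * -v' = -(r + n * v') by ring] at this
    have := ih v'
    omega

theorem DD_neg {n : ℕ} (hn : 2 ≤ n) (w : ℕ) (v : ℤ) : DD n w (-v) = DD n w v := by
  apply le_antisymm (DD_neg_le hn w v)
  simpa using DD_neg_le hn w (-v)

theorem DD_pos {n : ℕ} (hn : 2 ≤ n) (w : ℕ) (v : ℤ) (hv : v ≠ 0) : 1 ≤ DD n w v := by
  induction w generalizing v with
  | zero => rw [DD_zero]; omega
  | succ w ih =>
    obtain ⟨r, v', rfl, _, e⟩ := DD_exists hn w v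
    by_cases hr : r = 0
    · have := ih v' (by rintro rfl; simp [hr] at hv)
      omega
    · omega

theorem DD_add_pow {n : ℕ} (hn : 2 ≤ n) (W K : ℕ) (h : K ≤ W) (v s : ℤ) (hs : s.natAbs ≤ 1) :
    DD n W (v + s * (n : ℤ) ^ K) ≤ DD n W v + 1 := by
  induction K generalizing W v with
  | zero => simpa using DD_lip hn W v s hs
  | succ K ih =>
    obtain ⟨W, rfl⟩ : ∃ W', W = W' + 1 := ⟨W - 1, by omega⟩
    obtain ⟨r, v', rfl, _, e⟩ := DD_exists hn W v
    have h1 := DD_le hn W r (v' + s * (n : ℤ) ^ K)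
    rw [show r + n * (v' + s * (n : ℤ) ^ K) = r + n * v' + s * (n : ℤ) ^ (K + 1) by ring] at h1
    have := ih W (by omega) v'
    omega

/-- bound on the quotient -/
theorem quot_bound {n : ℕ} (hn : 2 ≤ n) {r v' : ℤ} {w : ℕ} (hr : r.natAbs < n)
    (h : |r + n * v'| ≤ (n : ℤ) ^ (w + 1)) : |v'| ≤ (n : ℤ) ^ w := by
  rw [abs_le] at *
  have hr1 : r < n := by omega
  have hr2 : -n < r := by omega
  rw [pow_succ'] at h
  constructor
  · by_contra hc
    have : v' + 1 ≤ -(n : ℤ) ^ w := by omega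
    nlinarith
  · by_contra hc
    have : (n : ℤ) ^ w + 1 ≤ v' := by omega
    nlinarith

theorem DD_stable {n : ℕ} (hn : 2 ≤ n) (w W : ℕ) (v : ℤ) (h : |v| ≤ (n : ℤ) ^ w) (hW : w ≤ W) :
    DD n W v = DD n w v := by
  apply le_antisymm (DD_anti hn hW v)
  induction w generalizing W v with
  | zero =>
    rw [DD_zero]
    simp at h
    by_cases hv : v = 0
    · simp [hv]
    · have := DD_pos hn W v hv
      rw [Int.abs_eq_natAbs] at h
      omega
  | succ w ih =>
    obtain ⟨W, rfl⟩ : ∃ W', W = W' + 1 := ⟨W - 1, by omega⟩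
    obtain ⟨r, v', rfl, hr, e⟩ := DD_exists hn W v
    have := ih W v' (quot_bound hn hr h) (by omega)
    have := DD_le hn w r v'
    omega

theorem DD_gap {n : ℕ} (hn : 2 ≤ n) (M : ℕ) (v : ℤ) (h : (n : ℤ) ^ (M + 2) ≤ |v|) :
    DD n (M + 1) v + 2 ≤ DD n M v := by
  induction M generalizing v with
  | zero =>
    wlog hv : 0 ≤ v generalizing v
    · have := this (-v) (by rwa [abs_neg]) (by omega)
      rwa [DD_neg hn, DD_neg hn] at this
    rw [abs_of_nonneg hv, zero_add, pow_two] at h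
    have h1 := Int.emod_nonneg v (show (n : ℤ) ≠ 0 by omega)
    have h2 := Int.emod_lt_of_pos v (show (0 : ℤ) < n by omega)
    have h3 := Int.emod_add_mul_ediv v n
    have h4 := DD_le hn 0 (v % n) (v / n)
    rw [h3] at h4
    rw [DD_zero] at *
    have hn' : (2 : ℤ) ≤ n := by exact_mod_cast hn
    have h5 : (2 : ℤ) ≤ v / n := by
      rw [Int.le_ediv_iff_mul_le (by omega)]
      nlinarith
    have h6 : v % n + v / n + 2 ≤ v := by nlinarith
    omega
  | succ M ih =>
    obtain ⟨r, v', rfl, hr, e⟩ := DD_exists hn M v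
    have h1 : (n : ℤ) ^ (M + 2) ≤ |v'| := by
      by_contra hc
      have hc' : |v'| + 1 ≤ (n : ℤ) ^ (M + 2) := by omega
      have t1 : |r + n * v'| ≤ |r| + n * |v'| := by
        refine (abs_add_le _ _).trans ?_
        rw [abs_mul]; simp
      have t2 : |r| < n := by rw [Int.abs_eq_natAbs]; exact_mod_cast hr
      have t3 : (n : ℤ) ^ (M + 1 + 2) = n * (n : ℤ) ^ (M + 2) := by ring
      have hn' : (2 : ℤ) ≤ n := by exact_mod_cast hn
      nlinarith
    have := ih v' h1
    have := DD_le hn (M + 1) r v'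
    omega

theorem DD_topA {n : ℕ} (hn : 2 ≤ n) (w W K : ℕ) (v : ℤ) (h0 : 0 ≤ v) (h : v ≤ (n : ℤ) ^ w)
    (hK : w + 1 ≤ K) : DD n w v + 1 ≤ DD n W (v + (n : ℤ) ^ K) := by
  have hn' : (2 : ℤ) ≤ n := by exact_mod_cast hn
  have hp : ∀ m : ℕ, (1 : ℤ) ≤ (n : ℤ) ^ m := fun m => one_le_pow₀ (by omega)
  induction w generalizing W K v with
  | zero =>
    rw [DD_zero]
    simp at h
    have hKp := hp K
    by_cases hv : v = 0
    · subst hv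
      have := DD_pos hn W (0 + (n : ℤ) ^ K) (by omega)
      simpa using this
    · have hv1 : v = 1 := by omega
      subst hv1
      cases W with
      | zero => rw [DD_zero]; omega
      | succ W =>
        obtain ⟨r, v', e0, hr, e⟩ := DD_exists hn W (1 + (n : ℤ) ^ K)
        obtain ⟨K, rfl⟩ : ∃ W', K = W' + 1 := ⟨K - 1, by omega⟩
        have hKp' := hp K
        rw [pow_succ'] at *
        have hr0 : r ≠ 0 := by
          rintro rfl
          have : (n : ℤ) ∣ 1 := ⟨v' - (n : ℤ) ^ K, by linarith⟩
          have := Int.le_of_dvd (by omega) this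
          omega
        have hv0 : v' ≠ 0 := by
          rintro rfl
          have : (n : ℤ) ≤ n * (n : ℤ) ^ K := by nlinarith
          omega
        have := DD_pos hn W v' hv0
        rw [e]
        omega
  | succ w ih =>
    obtain ⟨K, rfl⟩ : ∃ W', K = W' + 1 := ⟨K - 1, by omega⟩
    cases W with
    | zero =>
      rw [DD_zero]
      have := DD_le_abs hn (w + 1) v
      have := hp (K + 1)
      omega
    | succ W =>
      obtain ⟨r, v', e0, hr, e⟩ := DD_exists hn W (v + (n : ℤ) ^ (K + 1))
      have e1 : v = r + n * (v' - (n : ℤ) ^ K) := by rw [mul_sub, ← pow_succ']; linarith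
      have hb := quot_bound hn hr (w := w) (v' := v' - (n : ℤ) ^ K)
        (by rw [← e1, abs_of_nonneg h0]; exact h)
      have hpos : 0 ≤ v' - (n : ℤ) ^ K := by
        by_contra hc
        have : v' - (n : ℤ) ^ K ≤ -1 := by omega
        have : r < n := by omega
        nlinarith
      have := ih W K _ hpos (le_of_abs_le hb) (by omega)
      have h3 := DD_le hn w r (v' - (n : ℤ) ^ K)
      rw [← e1] at h3
      simp at this
      omega

/-- value of DD after adding a far top digit of the same sign -/
theorem DD_top {n : ℕ} (hn : 2 ≤ n) (w W K : ℕ) (v s : ℤ) (hs : (s = 1 ∧ 0 ≤ v) ∨ (s = -1 ∧ v ≤ 0))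
    (h : |v| ≤ (n : ℤ) ^ w) (hK : w + 1 ≤ K) (hW : K ≤ W) :
    DD n W (v + s * (n : ℤ) ^ K) = DD n w v + 1 := by
  apply le_antisymm
  · have := DD_add_pow hn W K hW v s (by omega)
    have := DD_anti hn (show w ≤ W by omega) v
    omega
  · rcases hs with ⟨rfl, h0⟩ | ⟨rfl, h0⟩
    · rw [one_mul]
      exact DD_topA hn w W K v h0 (le_of_abs_le h) hK
    · have := DD_topA hn w W K (-v) (by omega) (by rw [abs_of_nonpos h0] at h; exact h) hK
      rw [DD_neg hn, ← DD_neg hn W] at this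
      rwa [show -(-v + (n : ℤ) ^ K) = v + -1 * (n : ℤ) ^ K by ring] at this

def Dinf (n : ℕ) (v : ℤ) : ℕ := DD n v.natAbs v

theorem Dinf_eq {n : ℕ} (hn : 2 ≤ n) (w : ℕ) (v : ℤ) (h : |v| ≤ (n : ℤ) ^ w) :
    DD n w v = Dinf n v := by
  have h2 : |v| ≤ (n : ℤ) ^ v.natAbs := by
    rw [Int.abs_eq_natAbs]
    exact_mod_cast (Nat.lt_pow_self (by omega)).le
  rcases le_total w v.natAbs with hl | hl
  · exact (DD_stable hn _ _ v h hl).symm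
  · exact DD_stable hn _ _ v h2 hl

theorem Dinf_le {n : ℕ} (hn : 2 ≤ n) (w : ℕ) (v : ℤ) : Dinf n v ≤ DD n w v := by
  have h2 : |v| ≤ (n : ℤ) ^ v.natAbs := by
    rw [Int.abs_eq_natAbs]
    exact_mod_cast (Nat.lt_pow_self (by omega)).le
  rcases le_total w v.natAbs with hl | hl
  · exact DD_anti hn hl v
  · exact (DD_stable hn _ _ v h2 hl).ge

/-! ### the group -/

theorem bs_rel (n : ℕ) : bsT n * bsA n * (bsT n)⁻¹ = bsA n ^ n := by
  have h : (PresentedGroup.mk (bsRels n))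
      (FreeGroup.of 1 * FreeGroup.of 0 * (FreeGroup.of 1)⁻¹ * (FreeGroup.of 0 ^ n)⁻¹) = 1 :=
    PresentedGroup.one_of_mem (by simp [bsRels])
  rw [map_mul, map_mul, map_mul, map_inv, map_inv, map_pow, mul_inv_eq_one] at h
  exact h

theorem t_conj (n : ℕ) (v : ℤ) : bsT n * bsA n ^ v = bsA n ^ ((n : ℤ) * v) * bsT n := by
  have h : bsT n * bsA n ^ v * (bsT n)⁻¹ = (bsT n * bsA n * (bsT n)⁻¹) ^ v := by
    rw [conj_zpow]
  rw [bs_rel] at h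
  rw [zpow_mul, zpow_natCast, ← h]
  group

theorem tpow_conj (n k : ℕ) (v : ℤ) :
    bsT n ^ k * bsA n ^ v = bsA n ^ ((n : ℤ) ^ k * v) * bsT n ^ k := by
  induction k generalizing v with
  | zero => simp
  | succ k ih =>
    rw [pow_succ, mul_assoc, t_conj, ← mul_assoc, ih, mul_assoc]
    congr 2
    ring

def nf (n u : ℕ) (v : ℤ) (w : ℕ) : BS n := (bsT n ^ u)⁻¹ * bsA n ^ v * bsT n ^ w

theorem nf_mul_t (n u : ℕ) (v : ℤ) (w : ℕ) : nf n u v w * bsT n = nf n u v (w + 1) := by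
  simp [nf, pow_succ, mul_assoc]

theorem nf_mul_tinv (n u : ℕ) (v : ℤ) (w : ℕ) :
    nf n u v (w + 1) * (bsT n)⁻¹ = nf n u v w := by
  simp [nf, pow_succ, mul_assoc]

theorem nf_shift (n u : ℕ) (v : ℤ) (w : ℕ) :
    nf n (u + 1) (n * v) (w + 1) = nf n u v w := by
  have h := t_conj n v
  have h2 : bsA n ^ ((n : ℤ) * v) = bsT n * bsA n ^ v * (bsT n)⁻¹ := by rw [h]; group
  simp only [nf]
  rw [h2, pow_succ', pow_succ']
  have : bsT n * bsT n ^ u = bsT n ^ u * bsT n := by rw [← pow_succ, ← pow_succ']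
  rw [this]
  group

theorem nf_shift_pow (n j u : ℕ) (v : ℤ) (w : ℕ) :
    nf n (u + j) ((n : ℤ) ^ j * v) (w + j) = nf n u v w := by
  induction j with
  | zero => simp
  | succ j ih =>
    rw [pow_succ', mul_assoc]
    exact (nf_shift _ _ _ _).trans ih

theorem nf_mul_tinv0 (n u : ℕ) (v : ℤ) :
    nf n u v 0 * (bsT n)⁻¹ = nf n (u + 1) (n * v) 0 := by
  rw [← nf_shift, nf_mul_tinv]

theorem nf_mul_a (n u : ℕ) (v : ℤ) (w : ℕ) (s : ℤ) :
    nf n u v w * bsA n ^ s = nf n u (v + s * (n : ℤ) ^ w) w := by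
  simp only [nf]
  rw [mul_assoc, tpow_conj, mul_assoc, ← mul_assoc (bsA n ^ v), ← zpow_add, mul_comm s, ← mul_assoc]

theorem nf_inv (n u : ℕ) (v : ℤ) (w : ℕ) : (nf n u v w)⁻¹ = nf n w (-v) u := by
  simp [nf, mul_assoc]

/-- the affine action on `ℚ` -/
noncomputable def actGen (n : ℕ) (hn : (n : ℚ) ≠ 0) : Fin 2 → Equiv.Perm ℚ := fun i =>
  if i = 0 then Equiv.addRight (1 : ℚ) else Equiv.mulLeft₀ (n : ℚ) hn

theorem addRight_pow_apply (k : ℕ) (x : ℚ) :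
    ((Equiv.addRight (1 : ℚ) : Equiv.Perm ℚ) ^ k) x = x + k := by
  induction k generalizing x with
  | zero => simp
  | succ k ih =>
    rw [pow_succ, Equiv.Perm.mul_apply, ih]
    simp; ring

theorem addRight_zpow_apply (k : ℤ) (x : ℚ) :
    ((Equiv.addRight (1 : ℚ) : Equiv.Perm ℚ) ^ k) x = x + k := by
  obtain ⟨m, rfl | rfl⟩ := k.eq_nat_or_neg
  · rw [zpow_natCast, addRight_pow_apply]; simp
  · rw [zpow_neg, zpow_natCast, Equiv.Perm.inv_eq_iff_eq, addRight_pow_apply]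
    simp

theorem mulLeft_pow_apply (c : ℚ) (hc : c ≠ 0) (k : ℕ) (x : ℚ) :
    ((Equiv.mulLeft₀ c hc : Equiv.Perm ℚ) ^ k) x = c ^ k * x := by
  induction k generalizing x with
  | zero => simp
  | succ k ih =>
    rw [pow_succ, Equiv.Perm.mul_apply, ih]
    simp; ring

theorem act_rels (n : ℕ) (hn : (n : ℚ) ≠ 0) :
    ∀ r ∈ bsRels n, FreeGroup.lift (actGen n hn) r = 1 := by
  intro r hr
  simp only [bsRels, Set.mem_singleton_iff] at hr
  subst hr
  rw [map_mul, map_mul, map_mul, map_inv, map_inv, map_pow, mul_inv_eq_one, mul_inv_eq_iff_eq_mul]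
  ext x
  simp only [FreeGroup.lift_apply_of, actGen, Equiv.Perm.mul_apply, if_true, one_ne_zero, if_false]
  rw [addRight_pow_apply]
  simp
  ring

noncomputable def act (n : ℕ) (hn : (n : ℚ) ≠ 0) : BS n →* Equiv.Perm ℚ :=
  PresentedGroup.toGroup (act_rels n hn)

theorem act_nf (n : ℕ) (hn : (n : ℚ) ≠ 0) (u : ℕ) (v : ℤ) (w : ℕ) (x : ℚ) :
    (n : ℚ) ^ u * act n hn (nf n u v w) x = (n : ℚ) ^ w * x + v := by
  have hA : act n hn (bsA n) = Equiv.addRight (1 : ℚ) := by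
    simp [act, bsA, actGen]
  have hT : act n hn (bsT n) = Equiv.mulLeft₀ (n : ℚ) hn := by
    simp [act, bsT, actGen]
  rw [← mulLeft_pow_apply (n : ℚ) hn, nf, map_mul, map_mul, map_inv, map_pow, map_pow, map_zpow,
    hA, hT, Equiv.Perm.mul_apply, Equiv.Perm.mul_apply,
    ← Equiv.Perm.mul_apply, mul_inv_cancel, Equiv.Perm.one_apply,
    addRight_zpow_apply, mulLeft_pow_apply]

theorem nf_eq {n : ℕ} (hn : 2 ≤ n) {u w p W : ℕ} {v V : ℤ} (h : nf n u v w = nf n p V W) :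
    u + W = p + w ∧ v * (n : ℤ) ^ p = V * (n : ℤ) ^ u := by
  have hn0 : (n : ℚ) ≠ 0 := by positivity
  have e : ∀ x : ℚ, (n : ℚ) ^ p * ((n : ℚ) ^ w * x + v) = (n : ℚ) ^ u * ((n : ℚ) ^ W * x + V) := by
    intro x
    rw [← act_nf n hn0, ← act_nf n hn0, h]
    ring
  have e0 := e 0
  have e1 := e 1
  have h2 : v * (n : ℤ) ^ p = V * (n : ℤ) ^ u := by
    have : (v : ℚ) * (n : ℚ) ^ p = V * (n : ℚ) ^ u := by simp at e0; linarith
    exact_mod_cast this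
  refine ⟨?_, h2⟩
  have h3 : (n : ℚ) ^ (u + W) = (n : ℚ) ^ (p + w) := by
    rw [pow_add, pow_add]; simp at e0 e1; linarith
  have h4 : n ^ (u + W) = n ^ (p + w) := by exact_mod_cast h3
  exact Nat.pow_right_injective hn h4

def Red (n u : ℕ) (v : ℤ) (w : ℕ) : Prop := u = 0 ∨ w = 0 ∨ ¬ ((n : ℤ) ∣ v)

theorem nf_red_eq {n : ℕ} (hn : 2 ≤ n) {u w p W : ℕ} {v V : ℤ} (hr : Red n u v w)
    (h : nf n u v w = nf n p V W) : ∃ j, p = u + j ∧ W = w + j ∧ V = (n : ℤ) ^ j * v := by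
  obtain ⟨h1, h2⟩ := nf_eq hn h
  have hn0 : (n : ℤ) ≠ 0 := by omega
  by_cases hp : u ≤ p
  · obtain ⟨j, rfl⟩ := Nat.exists_eq_add_of_le hp
    refine ⟨j, rfl, by omega, ?_⟩
    apply mul_right_cancel₀ (pow_ne_zero u hn0)
    rw [← h2, pow_add]; ring
  · exfalso
    obtain ⟨j, rfl⟩ := Nat.exists_eq_add_of_le (show p ≤ u by omega)
    rcases hr with h | h | h
    · omega
    · omega
    · apply h
      have : v = (n : ℤ) ^ j * V := by
        apply mul_right_cancel₀ (pow_ne_zero p hn0)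
        rw [h2, pow_add]; ring
      rw [this]
      exact Dvd.dvd.mul_right (dvd_pow_self _ (by omega)) _

theorem nf_red_inj {n : ℕ} (hn : 2 ≤ n) {u w p W : ℕ} {v V : ℤ} (hr : Red n u v w)
    (hr' : Red n p V W) (h : nf n u v w = nf n p V W) : u = p ∧ v = V ∧ w = W := by
  obtain ⟨j, h1, h2, h3⟩ := nf_red_eq hn hr h
  obtain ⟨j', h1', h2', h3'⟩ := nf_red_eq hn hr' h.symm
  obtain rfl : j = 0 := by omega
  simp at *
  omega

theorem exists_red {n : ℕ} (u w : ℕ) (v : ℤ) :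
    ∃ u' v' w', Red n u' v' w' ∧ nf n u v w = nf n u' v' w' := by
  induction u generalizing v w with
  | zero => exact ⟨0, v, w, Or.inl rfl, rfl⟩
  | succ u ih =>
    by_cases h : Red n (u + 1) v w
    · exact ⟨_, _, _, h, rfl⟩
    · simp only [Red, not_or, not_not] at h
      obtain ⟨_, hw, v', rfl⟩ := h
      obtain ⟨w, rfl⟩ := Nat.exists_eq_succ_of_ne_zero hw
      rw [Nat.succ_eq_add_one, nf_shift]
      exact ih w v'

/-! ### words -/

theorem evalWord_append (n : ℕ) (a b : List Letter) :
    evalWord n (a ++ b) = evalWord n a * evalWord n b := by simp [evalWord]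

theorem letter_cases (n : ℕ) (l : Letter) :
    (∃ s : ℤ, s.natAbs = 1 ∧ evalLetter n l = bsA n ^ s) ∨ evalLetter n l = bsT n ∨
      evalLetter n l = (bsT n)⁻¹ := by
  obtain ⟨i, b⟩ := l
  fin_cases i <;> cases b
  · left; exact ⟨-1, rfl, by simp [evalLetter]⟩
  · left; exact ⟨1, rfl, by simp [evalLetter]⟩
  · right; right; simp [evalLetter]
  · right; left; simp [evalLetter]

theorem word_lower {n : ℕ} (hn : 2 ≤ n) (wd : List Letter) :
    ∃ (p : ℕ) (V : ℤ) (W M : ℕ), evalWord n wd = nf n p V W ∧ p ≤ M ∧ W ≤ M ∧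
      DD n M V + 2 * M ≤ wd.length + ((W : ℤ) - p).natAbs := by
  induction wd using List.reverseRecOn with
  | nil => exact ⟨0, 0, 0, 0, by simp [evalWord, nf], le_rfl, le_rfl, by simp [DD_zero]⟩
  | append_singleton wd l ih =>
    obtain ⟨p, V, W, M, e, h1, h2, h3⟩ := ih
    rw [evalWord_append, e]
    have e1 : evalWord n [l] = evalLetter n l := by simp [evalWord]
    rw [e1, List.length_append, List.length_singleton]
    rcases letter_cases n l with ⟨s, hs, e2⟩ | e2 | e2
    · refine ⟨p, V + s * (n : ℤ) ^ W, W, M, by rw [e2, nf_mul_a], h1, h2, ?_⟩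
      have := DD_add_pow hn M W h2 V s hs.le
      omega
    · by_cases hW : W + 1 ≤ M
      · exact ⟨p, V, W + 1, M, by rw [e2, nf_mul_t], h1, hW, by omega⟩
      · refine ⟨p, V, W + 1, M + 1, by rw [e2, nf_mul_t], by omega, by omega, ?_⟩
        have := DD_anti_succ hn M V
        omega
    · cases W with
      | succ W => exact ⟨p, V, W, M, by rw [e2, nf_mul_tinv], h1, by omega, by omega⟩
      | zero =>
        refine ⟨p + 1, n * V, 0, M + 1, by rw [e2, nf_mul_tinv0], by omega, by omega, ?_⟩
        rw [DD_shift hn]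
        omega

theorem eval_inv (n : ℕ) (wd : List Letter) :
    ∃ wd' : List Letter, evalWord n wd' = (evalWord n wd)⁻¹ ∧ wd'.length = wd.length := by
  induction wd with
  | nil => exact ⟨[], by simp [evalWord], rfl⟩
  | cons l wd ih =>
    obtain ⟨wd', h1, h2⟩ := ih
    refine ⟨wd' ++ [(l.1, !l.2)], ?_, by simp [h2]⟩
    rw [evalWord_append, h1]
    have : evalWord n (l :: wd) = evalLetter n l * evalWord n wd := by simp [evalWord]
    rw [this, mul_inv_rev]
    congr 1
    obtain ⟨i, b⟩ := l
    cases b <;> fin_cases i <;> simp [evalWord, evalLetter]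

/-- `g` has a word of length at most `L` -/
def WL (n : ℕ) (g : BS n) (L : ℕ) : Prop := ∃ wd : List Letter, evalWord n wd = g ∧ wd.length = L

theorem WL.mul {n : ℕ} {g h : BS n} {K L : ℕ} (hg : WL n g K) (hh : WL n h L) :
    WL n (g * h) (K + L) := by
  obtain ⟨a, rfl, rfl⟩ := hg
  obtain ⟨b, rfl, rfl⟩ := hh
  exact ⟨a ++ b, evalWord_append _ _ _, by simp⟩

theorem WL.inv {n : ℕ} {g : BS n} {K : ℕ} (hg : WL n g K) : WL n g⁻¹ K := by
  obtain ⟨a, rfl, rfl⟩ := hg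
  exact eval_inv n a

theorem WL.one (n : ℕ) : WL n 1 0 := ⟨[], by simp [evalWord], rfl⟩

theorem WL.t (n : ℕ) : WL n (bsT n) 1 := ⟨[(1, true)], by simp [evalWord, evalLetter], rfl⟩

theorem WL.a (n : ℕ) : WL n (bsA n) 1 := ⟨[(0, true)], by simp [evalWord, evalLetter], rfl⟩

theorem WL.pow {n : ℕ} {g : BS n} (hg : WL n g 1) (k : ℕ) : WL n (g ^ k) k := by
  induction k with
  | zero => simpa using WL.one n
  | succ k ih => rw [pow_succ]; exact ih.mul hg

theorem WL.zpow {n : ℕ} {g : BS n} (hg : WL n g 1) (k : ℤ) : WL n (g ^ k) k.natAbs := by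
  obtain ⟨m, rfl | rfl⟩ := k.eq_nat_or_neg
  · rw [zpow_natCast]; exact hg.pow m
  · rw [zpow_neg, zpow_natCast, Int.natAbs_neg]; exact (hg.pow m).inv

theorem WL.le {n : ℕ} {g : BS n} {L : ℕ} (h : WL n g L) : wordLength n g ≤ L := Nat.sInf_le h

theorem WL_up {n : ℕ} (hn : 2 ≤ n) (M : ℕ) (v : ℤ) :
    WL n (bsA n ^ v * bsT n ^ M) (DD n M v + M) := by
  induction M generalizing v with
  | zero => simpa [DD_zero] using (WL.a n).zpow v
  | succ M ih =>
    obtain ⟨r, v', rfl, _, e⟩ := DD_exists hn M v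
    have := (((WL.a n).zpow r).mul (WL.t n)).mul (ih v')
    rw [e]
    convert this using 1
    · rw [zpow_add, pow_succ', mul_assoc, mul_assoc, ← mul_assoc (bsT n) (bsA n ^ v'), t_conj, mul_assoc]
    · omega

theorem WL_nf1 {n : ℕ} (hn : 2 ≤ n) {u w M : ℕ} (v : ℤ) (h1 : u ≤ w) (h2 : w ≤ M) :
    WL n (nf n u v w) (DD n M v + 2 * M - (w - u)) := by
  have := ((((WL.t n).pow u).inv).mul (WL_up hn M v)).mul (((WL.t n).pow (M - w)).inv)
  convert this using 1
  · rw [nf, mul_assoc, mul_assoc, mul_assoc]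
    congr 2
    obtain ⟨j, rfl⟩ := Nat.exists_eq_add_of_le h2
    rw [Nat.add_sub_cancel_left, pow_add]; group
  · omega

theorem WL_nf {n : ℕ} (hn : 2 ≤ n) {u w M : ℕ} (v : ℤ) (h1 : u ≤ M) (h2 : w ≤ M) :
    WL n (nf n u v w) (DD n M v + 2 * M - ((w : ℤ) - u).natAbs) := by
  rcases le_total u w with h | h
  · convert WL_nf1 hn v h h2 using 1
    omega
  · convert (WL_nf1 hn (-v) h h1).inv using 1
    · rw [nf_inv, neg_neg]
    · rw [DD_neg hn]; omega

theorem wordLength_spec {n : ℕ} (hn : 2 ≤ n) (u w : ℕ) (v : ℤ) :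
    WL n (nf n u v w) (wordLength n (nf n u v w)) := by
  have : {N : ℕ | WL n (nf n u v w) N}.Nonempty :=
    ⟨_, WL_nf hn v (le_max_left u w) (le_max_right u w)⟩
  exact Nat.sInf_mem this

theorem exists_nf {n : ℕ} (hn : 2 ≤ n) (g : BS n) : ∃ u v w, Red n u v w ∧ g = nf n u v w := by
  have hall : ∀ g : BS n, ∃ u v w, g = nf n u v w := by
    intro g
    obtain ⟨y, rfl⟩ := QuotientGroup.mk_surjective g
    induction y using FreeGroup.induction_on with
    | C1 => exact ⟨0, 0, 0, by simp [nf]; rfl⟩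
    | of i =>
      fin_cases i
      · exact ⟨0, 1, 0, by simp [nf]; rfl⟩
      · exact ⟨0, 0, 1, by simp [nf]; rfl⟩
    | inv_of i h =>
      obtain ⟨u, v, w, h⟩ := h
      refine ⟨w, -v, u, ?_⟩
      rw [← nf_inv, ← h]; rfl
    | mul x y hx hy =>
      obtain ⟨u, v, w, hx⟩ := hx
      obtain ⟨u', v', w', hy⟩ := hy
      have hy2 : WL n (nf n u' v' w') _ := wordLength_spec hn u' w' v'
      have hx2 : WL n (nf n u v w) _ := wordLength_spec hn u w v
      obtain ⟨wd, h1, -⟩ := hx2.mul hy2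
      obtain ⟨p, V, W, M, e, -⟩ := word_lower hn wd
      refine ⟨p, V, W, ?_⟩
      rw [← e, h1, ← hx, ← hy]; rfl
  obtain ⟨u, v, w, rfl⟩ := hall g
  obtain ⟨u', v', w', h, e⟩ := exists_red (n := n) u w v
  exact ⟨u', v', w', h, e⟩

theorem len_le {n : ℕ} (hn : 2 ≤ n) {u w M : ℕ} (v : ℤ) (h1 : u ≤ M) (h2 : w ≤ M) :
    wordLength n (nf n u v w) + ((w : ℤ) - u).natAbs ≤ DD n M v + 2 * M := by
  have := (WL_nf hn v h1 h2).le
  omega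

theorem len_ge {n : ℕ} (hn : 2 ≤ n) {u w : ℕ} {v : ℤ} (hr : Red n u v w) :
    ∃ M, u ≤ M ∧ w ≤ M ∧
      DD n M v + 2 * M ≤ wordLength n (nf n u v w) + ((w : ℤ) - u).natAbs := by
  obtain ⟨wd, h1, h2⟩ := wordLength_spec hn u w v
  obtain ⟨p, V, W, M, e, h3, h4, h5⟩ := word_lower hn wd
  rw [h1] at e
  obtain ⟨j, rfl, rfl, rfl⟩ := nf_red_eq hn hr e
  obtain ⟨M, rfl⟩ := Nat.exists_eq_add_of_le (show j ≤ M by omega)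
  rw [add_comm j M, DD_shift_pow hn] at h5
  exact ⟨M, by omega, by omega, by omega⟩

theorem len_eq {n : ℕ} (hn : 2 ≤ n) {u w d : ℕ} {v : ℤ} (hr : Red n u v w)
    (h : ∀ M, u ≤ M → w ≤ M → DD n M v = d) : wordLength n (nf n u v w) = d + u + w := by
  obtain ⟨M, h1, h2, h3⟩ := len_ge hn hr
  have h4 := len_le hn v (le_max_left u w) (le_max_right u w)
  rw [h M h1 h2] at h3
  rw [h _ (le_max_left u w) (le_max_right u w)] at h4
  omega

theorem len_inv {n : ℕ} (hn : 2 ≤ n) (g : BS n) : wordLength n g⁻¹ = wordLength n g := by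
  have key : ∀ g : BS n, wordLength n g⁻¹ ≤ wordLength n g := by
    intro g
    obtain ⟨u, v, w, _, rfl⟩ := exists_nf hn g
    exact ((wordLength_spec hn u w v).inv).le
  apply le_antisymm (key g)
  simpa using key g⁻¹

theorem words_finite (N : ℕ) : {wd : List Letter | wd.length = N}.Finite :=
  List.finite_length_eq Letter N

theorem sphere_finite {n : ℕ} (hn : 2 ≤ n) (N : ℕ) : (bsSphere n N).Finite := by
  apply ((words_finite N).image (evalWord n)).subset
  intro g hg
  obtain ⟨u, v, w, _, rfl⟩ := exists_nf hn g
  obtain ⟨wd, h1, h2⟩ := wordLength_spec hn u w v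
  exact ⟨wd, h2.trans hg, h1⟩

/-! ### digit functions -/

def sumD (n M : ℕ) (f : ℕ → ℤ) : ℤ := ∑ i ∈ Finset.range (M + 1), f i * (n : ℤ) ^ i

def l1F (M : ℕ) (f : ℕ → ℤ) : ℕ := ∑ i ∈ Finset.range (M + 1), (f i).natAbs

theorem sumD_zero (n : ℕ) (f : ℕ → ℤ) : sumD n 0 f = f 0 := by simp [sumD]

theorem l1F_zero (f : ℕ → ℤ) : l1F 0 f = (f 0).natAbs := by simp [l1F]

theorem sumD_succ (n M : ℕ) (f : ℕ → ℤ) :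
    sumD n (M + 1) f = f 0 + n * sumD n M (fun i => f (i + 1)) := by
  rw [sumD, Finset.sum_range_succ', sumD, Finset.mul_sum, add_comm]
  congr 1
  · simp
  · apply Finset.sum_congr rfl
    intro i _
    ring

theorem l1F_succ (M : ℕ) (f : ℕ → ℤ) :
    l1F (M + 1) f = (f 0).natAbs + l1F M (fun i => f (i + 1)) := by
  rw [l1F, Finset.sum_range_succ', l1F, add_comm]

theorem DD_le_l1F {n : ℕ} (hn : 2 ≤ n) (M : ℕ) (f : ℕ → ℤ) : DD n M (sumD n M f) ≤ l1F M f := by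
  induction M generalizing f with
  | zero => rw [sumD_zero, l1F_zero, DD_zero]
  | succ M ih =>
    rw [sumD_succ, l1F_succ]
    have := DD_le hn M (f 0) (sumD n M (fun i => f (i + 1)))
    have := ih (fun i => f (i + 1))
    omega

def consF (r : ℤ) (f : ℕ → ℤ) : ℕ → ℤ
  | 0 => r
  | i + 1 => f i

theorem consF_zero (r : ℤ) (f : ℕ → ℤ) : consF r f 0 = r := rfl

theorem sumD_cons (n M : ℕ) (r : ℤ) (f : ℕ → ℤ) :
    sumD n (M + 1) (consF r f) = r + n * sumD n M f := sumD_succ n M (consF r f)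

theorem l1F_cons (M : ℕ) (r : ℤ) (f : ℕ → ℤ) :
    l1F (M + 1) (consF r f) = r.natAbs + l1F M f := l1F_succ M (consF r f)

theorem exists_opt {n : ℕ} (hn : 2 ≤ n) (M : ℕ) (v : ℤ) :
    ∃ f : ℕ → ℤ, sumD n M f = v ∧ l1F M f = DD n M v := by
  induction M generalizing v with
  | zero => exact ⟨fun _ => v, by rw [sumD_zero], by rw [l1F_zero, DD_zero]⟩
  | succ M ih =>
    obtain ⟨r, v', rfl, _, e⟩ := DD_exists hn M v
    obtain ⟨f, h1, h2⟩ := ih v'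
    refine ⟨consF r f, ?_, ?_⟩
    · rw [sumD_cons, h1]
    · rw [l1F_cons, e, h2]

theorem opt_supp {n : ℕ} (hn : 2 ≤ n) (w M : ℕ) (f : ℕ → ℤ)
    (hf : l1F M f ≤ DD n M (sumD n M f)) (hv : |sumD n M f| ≤ (n : ℤ) ^ w) :
    ∀ i, w < i → i ≤ M → f i = 0 := by
  induction M generalizing w f with
  | zero => intro i h1 h2; omega
  | succ M ih =>
    rw [sumD_succ, l1F_succ] at hf
    rw [sumD_succ] at hv
    set r := f 0 with hr
    set f' := fun i => f (i + 1) with hf'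
    set v' := sumD n M f' with hv'
    have h1 := DD_le hn M r v'
    have h2 := DD_le_l1F hn M f'
    rw [← hv'] at h2
    have hrn : r.natAbs < n := by
      by_contra hc
      rcases le_total 0 r with h0 | h0
      · have h3 := DD_le hn M (r - n) (v' + 1)
        rw [show r - n + n * (v' + 1) = r + n * v' by ring] at h3
        have := DD_lip hn M v' 1 (by simp)
        omega
      · have h3 := DD_le hn M (r + n) (v' + -1)
        rw [show r + n + n * (v' + -1) = r + n * v' by ring] at h3
        have := DD_lip hn M v' (-1) (by simp)
        omega
    cases w with
    | zero =>
      have h3 := DD_le_abs hn (M + 1) (r + n * v')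
      simp only [pow_zero] at hv
      rw [Int.abs_eq_natAbs] at hv
      have hz : l1F M f' = 0 := by
        by_contra hc
        have hr0 : r = 0 := by omega
        rw [hr0] at hv h3 hf
        simp only [zero_add, Int.natAbs_mul, Int.natAbs_natCast, Int.natAbs_zero] at *
        have : v'.natAbs ≠ 0 := by
          intro h
          rw [h] at h3
          omega
        have : n * 1 ≤ n * v'.natAbs := Nat.mul_le_mul_left _ (by omega)
        have : ((n * v'.natAbs : ℕ) : ℤ) ≤ 1 := hv
        omega
      intro i hi hiM
      have := (Finset.sum_eq_zero_iff.mp hz) (i - 1) (by simp; omega)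
      rw [hf'] at this
      simp only at this
      rw [show i - 1 + 1 = i by omega] at this
      omega
    | succ w =>
      intro i hi hiM
      have := ih w f' (by rw [← hv']; omega) (quot_bound hn hrn hv) (i - 1) (by omega) (by omega)
      rw [hf'] at this
      simp only at this
      rwa [show i - 1 + 1 = i by omega] at this

/-- lexicographic comparison of absolute values for functions, up to index `M` -/
def lexF (M : ℕ) (f g : ℕ → ℤ) : Prop :=
  (∀ i ≤ M, |f i| = |g i|) ∨ ∃ i ≤ M, (∀ j < i, |f j| = |g j|) ∧ |f i| < |g i|

def IsOpt (n M : ℕ) (f : ℕ → ℤ) : Prop :=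
  l1F M f ≤ DD n M (sumD n M f) ∧
    ∀ g, sumD n M g = sumD n M f → l1F M g ≤ DD n M (sumD n M f) → lexF M f g

theorem exists_isOpt {n : ℕ} (hn : 2 ≤ n) (M : ℕ) (v : ℤ) :
    ∃ f : ℕ → ℤ, sumD n M f = v ∧ IsOpt n M f := by
  let S : Set (ℕ → ℤ) := {f | sumD n M f = v ∧ l1F M f ≤ DD n M v}
  let φ : (ℕ → ℤ) → Lex (Fin (M + 1) → ℕ) := fun f => toLex fun i => (f i).natAbs
  obtain ⟨f0, h01, h02⟩ := exists_opt hn M v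
  have wf : WellFounded (fun a b : Lex (Fin (M + 1) → ℕ) => a < b) := wellFounded_lt
  obtain ⟨f, hf, hmin⟩ := (InvImage.wf φ wf).has_min S ⟨f0, h01, h02.le⟩
  refine ⟨f, hf.1, by rw [hf.1]; exact hf.2, ?_⟩
  intro g hg1 hg2
  rw [hf.1] at hg1 hg2
  have h := hmin g ⟨hg1, hg2⟩
  have h' : φ f ≤ φ g := not_lt.mp h
  rcases h'.eq_or_lt with he | hl
  · left
    intro i hi
    have := congrFun (toLex.injective he) ⟨i, by omega⟩
    simp only at this
    rw [Int.abs_eq_natAbs, Int.abs_eq_natAbs, this]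
  · right
    obtain ⟨i, hi1, hi2⟩ := hl
    refine ⟨i.1, by omega, ?_, ?_⟩
    · intro j hj
      have : (f j).natAbs = (g j).natAbs := hi1 ⟨j, by omega⟩ hj
      rw [Int.abs_eq_natAbs, Int.abs_eq_natAbs, this]
    · have : (f i).natAbs < (g i).natAbs := hi2
      rw [Int.abs_eq_natAbs, Int.abs_eq_natAbs]
      exact_mod_cast this

theorem IsOpt.tail {n : ℕ} (hn : 2 ≤ n) {M : ℕ} {f : ℕ → ℤ} (h : IsOpt n (M + 1) f) :
    IsOpt n M (fun i => f (i + 1)) := by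
  obtain ⟨h1, h2⟩ := h
  rw [sumD_succ, l1F_succ] at h1
  have h3 := DD_le hn M (f 0) (sumD n M fun i => f (i + 1))
  have h4 := DD_le_l1F hn M fun i => f (i + 1)
  have h5 := DD_le_l1F hn (M + 1) f
  rw [sumD_succ, l1F_succ] at h5
  refine ⟨by omega, ?_⟩
  intro g hg1 hg2
  have := h2 (consF (f 0) g) (by rw [sumD_cons, sumD_succ, hg1])
    (by rw [sumD_succ, l1F_cons]; omega)
  rcases this with h | ⟨i, hi, hj, hl⟩
  · left
    intro i hi
    exact h (i + 1) (by omega)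
  · right
    cases i with
    | zero => simp [consF] at hl
    | succ i =>
      refine ⟨i, by omega, ?_, hl⟩
      intro j hj'
      exact hj (j + 1) (by omega)

theorem IsOpt.head {n : ℕ} (hn : 2 ≤ n) {M : ℕ} {f : ℕ → ℤ} (h : IsOpt n (M + 1) f) :
    |f 0| ≤ ((n / 2 : ℕ) : ℤ) := by
  obtain ⟨h1, h2⟩ := h
  have h5 := DD_le_l1F hn (M + 1) f
  rw [sumD_succ, l1F_succ] at h1 h5
  set r := f 0 with hr
  set v' := sumD n M fun i => f (i + 1) with hv'
  have h4 := DD_le_l1F hn M fun i => f (i + 1)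
  rw [← hv'] at h4
  by_contra hc
  rw [Int.abs_eq_natAbs] at hc
  obtain ⟨s, hs, hs2⟩ : ∃ s : ℤ, s.natAbs ≤ 1 ∧ (r - s * n).natAbs + 1 ≤ r.natAbs := by
    rcases le_total 0 r with h0 | h0
    · exact ⟨1, by simp, by omega⟩
    · exact ⟨-1, by simp, by omega⟩
  obtain ⟨g, hg1, hg2⟩ := exists_opt hn M (v' + s)
  have h6 := DD_lip hn M v' s hs
  have hd := DD_le hn M r v'
  have := h2 (consF (r - s * n) g)
    (by rw [sumD_cons, sumD_succ, ← hv', ← hr, hg1]; ring)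
    (by rw [sumD_succ, l1F_cons, ← hv', ← hr, hg2]; omega)
  have h7 : |consF (r - s * n) g 0| < |f 0| := by
    rw [consF_zero]
    rw [Int.abs_eq_natAbs, Int.abs_eq_natAbs, ← hr]
    omega
  rcases this with h | ⟨i, hi, hj, hl⟩
  · have := h 0 (by omega)
    omega
  · cases i with
    | zero => omega
    | succ i =>
      have := hj 0 (by omega)
      omega

theorem IsOpt.box {n : ℕ} (hn : 2 ≤ n) {M : ℕ} {f : ℕ → ℤ} (h : IsOpt n M f) (i : ℕ)
    (hi : i < M) : |f i| ≤ ((n / 2 : ℕ) : ℤ) := by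
  induction i generalizing M f with
  | zero =>
    obtain ⟨M, rfl⟩ : ∃ W', M = W' + 1 := ⟨M - 1, by omega⟩
    exact h.head hn
  | succ i ih =>
    obtain ⟨M, rfl⟩ : ∃ W', M = W' + 1 := ⟨M - 1, by omega⟩
    exact ih (h.tail hn) (by omega)

theorem sumD_bound {n : ℕ} (hn : 2 ≤ n) (M : ℕ) (f : ℕ → ℤ)
    (h : ∀ i ≤ M, |f i| ≤ ((n / 2 : ℕ) : ℤ)) : |sumD n M f| < (n : ℤ) ^ (M + 1) := by
  induction M generalizing f with
  | zero =>
    rw [sumD_zero]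
    have := h 0 le_rfl
    simp only [zero_add, pow_one]
    omega
  | succ M ih =>
    rw [sumD_succ]
    have h1 := ih (fun i => f (i + 1)) (fun i hi => h (i + 1) (by omega))
    have h2 := h 0 (by omega)
    have h3 : |f 0 + n * sumD n M fun i => f (i + 1)| ≤
        |f 0| + n * |sumD n M fun i => f (i + 1)| := by
      refine (abs_add_le _ _).trans ?_
      rw [abs_mul]; simp
    have h4 : ((n / 2 : ℕ) : ℤ) < n := by omega
    have h5 : (n : ℤ) ^ (M + 1 + 1) = n * (n : ℤ) ^ (M + 1) := by ring
    nlinarith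

theorem uniq_odd {n : ℕ} (hn : 2 ≤ n) (ho : ¬ Even n) (M : ℕ) (f g : ℕ → ℤ)
    (hf : ∀ i ≤ M, |f i| ≤ ((n / 2 : ℕ) : ℤ)) (hg : ∀ i ≤ M, |g i| ≤ ((n / 2 : ℕ) : ℤ))
    (h : sumD n M f = sumD n M g) : ∀ i ≤ M, f i = g i := by
  rw [Nat.not_even_iff] at ho
  induction M generalizing f g with
  | zero =>
    rw [sumD_zero, sumD_zero] at h
    intro i hi
    obtain rfl : i = 0 := by omega
    exact h
  | succ M ih =>
    rw [sumD_succ, sumD_succ] at h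
    have h1 := abs_le.mp (hf 0 (by omega))
    have h2 := abs_le.mp (hg 0 (by omega))
    have hd : (n : ℤ) ∣ f 0 - g 0 :=
      ⟨(sumD n M fun i => g (i + 1)) - (sumD n M fun i => f (i + 1)), by linarith⟩
    have h0 : f 0 - g 0 = 0 := Int.eq_zero_of_abs_lt_dvd hd (by rw [abs_lt]; omega)
    have hs : (sumD n M fun i => f (i + 1)) = (sumD n M fun i => g (i + 1)) := by
      apply mul_left_cancel₀ (show (n : ℤ) ≠ 0 by omega)
      linarith
    have := ih _ _ (fun i hi => hf (i + 1) (by omega)) (fun i hi => hg (i + 1) (by omega)) hs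
    intro i hi
    cases i with
    | zero => omega
    | succ i => exact this i (by omega)

theorem sumD_mod2 {n : ℕ} (he : Even n) (M : ℕ) (f : ℕ → ℤ) : (2 : ℤ) ∣ sumD n M f - f 0 := by
  cases M with
  | zero => simp [sumD_zero]
  | succ M =>
    obtain ⟨m, rfl⟩ := he
    rw [sumD_succ]
    exact ⟨m * sumD (m + m) M fun i => f (i + 1), by push_cast; ring⟩

theorem uniq_even {n : ℕ} (hn : 2 ≤ n) (he : Even n) (M : ℕ) (f g : ℕ → ℤ)
    (hf : ∀ i ≤ M, |f i| ≤ ((n / 2 : ℕ) : ℤ)) (hg : ∀ i ≤ M, |f i| = |g i|)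
    (h : sumD n M f = sumD n M g) : ∀ i ≤ M, f i = g i := by
  induction M generalizing f g with
  | zero =>
    rw [sumD_zero, sumD_zero] at h
    intro i hi
    obtain rfl : i = 0 := by omega
    exact h
  | succ M ih =>
    rw [sumD_succ, sumD_succ] at h
    have h1 := abs_le.mp (hf 0 (by omega))
    have h2 := abs_eq_abs.mp (hg 0 (by omega))
    have p1 := sumD_mod2 he M fun i => f (i + 1)
    have p2 := sumD_mod2 he M fun i => g (i + 1)
    have h3 := abs_eq_abs.mp (hg 1 (by omega))
    have ih := ih _ _ (fun i hi => hf (i + 1) (by omega)) (fun i hi => hg (i + 1) (by omega))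
    set F := sumD n M fun i => f (i + 1)
    set G := sumD n M fun i => g (i + 1)
    simp only [zero_add] at p1 p2
    have h0 : f 0 = g 0 := by
      by_contra hc
      have hfg : f 0 = - g 0 := by omega
      have e : 2 * f 0 = n * (G - F) := by linarith
      have hne : G - F ≠ 0 := by
        intro h'
        rw [h'] at e
        simp at e
        omega
      have hle : |G - F| ≤ 1 := by
        by_contra hcc
        have : 2 ≤ |G - F| := by omega
        have e2 : |2 * f 0| = n * |G - F| := by rw [e, abs_mul]; simp
        have e3 : |2 * f 0| ≤ n := by rw [abs_le]; omega
        have hn' : (2 : ℤ) ≤ n := by exact_mod_cast hn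
        nlinarith
      have := abs_le.mp hle
      omega
    have hs : F = G := by
      apply mul_left_cancel₀ (show (n : ℤ) ≠ 0 by omega)
      linarith
    intro i hi
    cases i with
    | zero => exact h0
    | succ i => exact ih hs i (by omega)

/-! ### link with finitely supported functions -/

theorem zero_of_kIdx {x : ℕ →₀ ℤ} {i : ℕ} (h : kIdx x < i) : x i = 0 := by
  by_contra hc
  have : i ∈ x.support := Finsupp.mem_support_iff.mpr hc
  have : i ≤ kIdx x := Finset.le_sup (f := id) this
  omega

theorem kIdx_le {x : ℕ →₀ ℤ} {M : ℕ} (h : ∀ i, M < i → x i = 0) : kIdx x ≤ M := by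
  apply Finset.sup_le
  intro i hi
  by_contra hc
  exact (Finsupp.mem_support_iff.mp hi) (h i (by simpa using hc))

theorem sigmaD_eq (n : ℕ) (x : ℕ →₀ ℤ) {M : ℕ} (h : kIdx x ≤ M) : sigmaD n x = sumD n M x := by
  apply Finsupp.sum_of_support_subset
  · intro i hi
    have : i ≤ kIdx x := Finset.le_sup (f := id) hi
    simp; omega
  · simp

theorem l1D_eq (x : ℕ →₀ ℤ) {M : ℕ} (h : kIdx x ≤ M) : l1D x = l1F M x := by
  apply Finsupp.sum_of_support_subset
  · intro i hi
    have : i ≤ kIdx x := Finset.le_sup (f := id) hi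
    simp; omega
  · simp

theorem exists_finsupp (M : ℕ) (f : ℕ → ℤ) :
    ∃ x : ℕ →₀ ℤ, (∀ i ≤ M, x i = f i) ∧ kIdx x ≤ M := by
  refine ⟨Finsupp.onFinset (Finset.range (M + 1)) (fun i => if i ≤ M then f i else 0) ?_, ?_, ?_⟩
  · intro i hi
    by_contra hc
    simp at hc hi
    omega
  · intro i hi
    simp [hi]
  · apply kIdx_le
    intro i hi
    simp
    omega

theorem sumD_congr {n M : ℕ} {f g : ℕ → ℤ} (h : ∀ i ≤ M, f i = g i) : sumD n M f = sumD n M g := by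
  apply Finset.sum_congr rfl
  intro i hi
  rw [h i (by simp at hi; omega)]

theorem l1F_congr {M : ℕ} {f g : ℕ → ℤ} (h : ∀ i ≤ M, f i = g i) : l1F M f = l1F M g := by
  apply Finset.sum_congr rfl
  intro i hi
  rw [h i (by simp at hi; omega)]

theorem etaLen_eq (u w : ℕ) (x : ℕ →₀ ℤ) :
    etaLen u w x + ((w : ℤ) - u).natAbs = l1D x + 2 * max (kIdx x) (max u w) := by
  unfold etaLen
  split_ifs <;> omega

/-! ### words and minimal vectors -/

theorem evalWord_aWord (n : ℕ) (m : ℤ) : evalWord n (aWord m) = bsA n ^ m := by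
  unfold evalWord aWord
  rw [List.map_replicate, List.prod_replicate]
  by_cases h : 0 < m
  · obtain ⟨k, rfl⟩ := Int.eq_ofNat_of_zero_le h.le
    have h' : decide (0 < (k : ℤ)) = true := by simpa using h
    rw [h']
    simp [evalLetter]
  · obtain ⟨k, hk⟩ := Int.eq_ofNat_of_zero_le (show 0 ≤ -m by omega)
    obtain rfl : m = -k := by omega
    have h' : decide (0 < -(k : ℤ)) = false := by simp
    rw [h']
    simp [evalLetter]

theorem evalWord_tWord (n : ℕ) (m : ℤ) : evalWord n (tWord m) = bsT n ^ m := by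
  unfold evalWord tWord
  rw [List.map_replicate, List.prod_replicate]
  by_cases h : 0 < m
  · obtain ⟨k, rfl⟩ := Int.eq_ofNat_of_zero_le h.le
    have h' : decide (0 < (k : ℤ)) = true := by simpa using h
    rw [h']
    simp [evalLetter]
  · obtain ⟨k, hk⟩ := Int.eq_ofNat_of_zero_le (show 0 ≤ -m by omega)
    obtain rfl : m = -k := by omega
    have h' : decide (0 < -(k : ℤ)) = false := by simp
    rw [h']
    simp [evalLetter]

def midW (f : ℕ → ℤ) (k : ℕ) : List Letter :=
  aWord (f 0) ++ (((List.range k).map fun j => tWord 1 ++ aWord (f (j + 1))).flatten)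

theorem midW_zero (f : ℕ → ℤ) : midW f 0 = aWord (f 0) := by simp [midW]

theorem midW_succ (f : ℕ → ℤ) (k : ℕ) :
    midW f (k + 1) = midW f k ++ (tWord 1 ++ aWord (f (k + 1))) := by
  simp [midW, List.range_succ]

theorem eta1_mid (u w : ℕ) (x : ℕ →₀ ℤ) :
    eta1Word u w x = tWord (-(u : ℤ)) ++ midW x (kIdx x) ++ tWord ((w : ℤ) - kIdx x) := by
  simp [eta1Word, midW]

theorem midW_length (f : ℕ → ℤ) (k : ℕ) : (midW f k).length = l1F k f + k := by
  induction k with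
  | zero => simp [midW_zero, aWord, l1F_zero]
  | succ k ih =>
    rw [midW_succ, List.length_append, ih]
    simp only [l1F]
    rw [Finset.sum_range_succ _ (k + 1)]
    simp [tWord, aWord]
    omega

theorem midW_count (f : ℕ → ℤ) (k : ℕ) : (midW f k).count (1, false) = 0 := by
  induction k with
  | zero => simp [midW_zero, aWord, List.count_replicate]
  | succ k ih =>
    rw [midW_succ, List.count_append, ih]
    simp [tWord, aWord, List.count_replicate]

theorem midW_eval (n : ℕ) (f : ℕ → ℤ) (k : ℕ) : evalWord n (midW f k) = nf n 0 (sumD n k f) k := by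
  induction k with
  | zero => simp [midW_zero, evalWord_aWord, sumD_zero, nf]
  | succ k ih =>
    rw [midW_succ, evalWord_append, evalWord_append, ih, evalWord_tWord, evalWord_aWord, zpow_one,
      ← mul_assoc, nf_mul_t, nf_mul_a]
    congr 1
    simp only [sumD]
    rw [Finset.sum_range_succ _ (k + 1)]

theorem eta1_length (u w : ℕ) (x : ℕ →₀ ℤ) (h : kIdx x ≤ w) :
    (eta1Word u w x).length = u + w + l1D x := by
  rw [eta1_mid, List.length_append, List.length_append, midW_length, l1D_eq x le_rfl]
  simp only [tWord, List.length_replicate]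
  omega

theorem eta1_count (u w : ℕ) (x : ℕ →₀ ℤ) (h : kIdx x ≤ w) :
    (eta1Word u w x).count (1, false) = u := by
  rw [eta1_mid, List.count_append, List.count_append, midW_count]
  simp only [tWord, List.count_replicate]
  have h1 : decide (0 < -(u : ℤ)) = false := by simp
  rw [h1]
  by_cases h2 : kIdx x = w
  · simp [h2]
  · have h3 : decide (0 < (w : ℤ) - kIdx x) = true := by simp; omega
    rw [h3]
    simp

theorem eta1_eval (n u w : ℕ) (x : ℕ →₀ ℤ) (h : kIdx x ≤ w) :
    evalWord n (eta1Word u w x) = nf n u (sigmaD n x) w := by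
  rw [eta1_mid, evalWord_append, evalWord_append, evalWord_tWord, evalWord_tWord, midW_eval,
    sigmaD_eq n x le_rfl]
  obtain ⟨d, rfl⟩ : ∃ d, w = kIdx x + d := ⟨w - kIdx x, by omega⟩
  rw [show ((kIdx x + d : ℕ) : ℤ) - kIdx x = (d : ℤ) by push_cast; ring]
  simp [nf, pow_add, mul_assoc]

/-- data of a minimal strict shape one word -/
structure OP (n u w : ℕ) (v : ℤ) (x : ℕ →₀ ℤ) : Prop where
  ne : x ≠ 0
  sig : sigmaD n x = v
  box : x ∈ BoxSet n u w (sigmaD n x)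
  min : IsMinimalVec n u w x
  lt : kIdx x < w

theorem OP.digit {n u w : ℕ} {v : ℤ} {x : ℕ →₀ ℤ} (h : OP n u w v x) (i : ℕ) :
    |x i| ≤ ((n / 2 : ℕ) : ℤ) := by
  obtain ⟨_, b1, b2, _⟩ := h.box
  have := h.lt
  rcases lt_trichotomy i (kIdx x) with hi | hi | hi
  · exact b1 i hi
  · rw [hi]; exact b2 (by omega)
  · rw [zero_of_kIdx hi, abs_zero]; omega

theorem OP.bound {n u w : ℕ} (hn : 2 ≤ n) {v : ℤ} {x : ℕ →₀ ℤ} (h : OP n u w v x) :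
    |v| < (n : ℤ) ^ w := by
  have := h.lt
  obtain ⟨w, rfl⟩ : ∃ w', w = w' + 1 := ⟨w - 1, by omega⟩
  rw [← h.sig, sigmaD_eq n x (show kIdx x ≤ w by omega)]
  exact sumD_bound hn w x fun i _ => h.digit i

theorem pow_mono' {n : ℕ} (hn : 2 ≤ n) {a b : ℕ} (h : a ≤ b) : (n : ℤ) ^ a ≤ (n : ℤ) ^ b :=
  pow_le_pow_right₀ (by exact_mod_cast (by omega : 1 ≤ n)) h

theorem OP.len {n u w : ℕ} (hn : 2 ≤ n) {v : ℤ} {x : ℕ →₀ ℤ} (h : OP n u w v x) :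
    l1D x = Dinf n v := by
  have hb := h.bound hn
  have hlt := h.lt
  obtain ⟨f, hf1, hf2⟩ := exists_opt hn (max u w) v
  obtain ⟨y, hy1, hy2⟩ := exists_finsupp (max u w) f
  have hy3 : sigmaD n y = v := by rw [sigmaD_eq n y hy2, sumD_congr hy1, hf1]
  have hy4 : l1D y = DD n (max u w) v := by rw [l1D_eq y hy2, l1F_congr hy1, hf2]
  have hm := h.min.1 y (by rw [hy3, h.sig])
  have e1 := etaLen_eq u w x
  have e2 := etaLen_eq u w y
  have hge := DD_le_l1F hn w x
  rw [← sigmaD_eq n x hlt.le, h.sig, ← l1D_eq x hlt.le] at hge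
  have := Dinf_eq hn w v hb.le
  have := Dinf_eq hn (max u w) v (hb.le.trans (pow_mono' hn (le_max_right _ _)))
  omega

theorem l1D_zero_iff {x : ℕ →₀ ℤ} (h : l1D x = 0) : x = 0 := by
  ext i
  by_contra hc
  have : i ∈ x.support := Finsupp.mem_support_iff.mpr hc
  have := (Finset.sum_eq_zero_iff.mp h) i this
  simp at this hc
  exact hc this

theorem OP.vne {n u w : ℕ} (hn : 2 ≤ n) {v : ℤ} {x : ℕ →₀ ℤ} (h : OP n u w v x) : v ≠ 0 := by
  rintro rfl
  have h1 := h.len hn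
  have h2 := Dinf_le hn 0 0
  rw [DD_zero] at h2
  exact h.ne (l1D_zero_iff (by simp at h2; omega))

theorem absLex_antisymm {x y : ℕ →₀ ℤ} (h : absLexLE x y) (h' : absLexLE y x) :
    ∀ i, |x i| = |y i| := by
  rcases h with h | ⟨i, hi, hl⟩
  · exact h
  · rcases h' with h' | ⟨j, hj, hl'⟩
    · exact fun i => (h' i).symm
    · exfalso
      rcases lt_trichotomy i j with hij | hij | hij
      · have := hj i hij; omega
      · subst hij; omega
      · have := hi j hij; omega

theorem OP.uniq {n u w : ℕ} (hn : 2 ≤ n) {v : ℤ} {x y : ℕ →₀ ℤ} (h : OP n u w v x)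
    (h' : OP n u w v y) : x = y := by
  have l1 := h.lt
  have l2 := h'.lt
  have hs : sumD n w x = sumD n w y := by
    rw [← sigmaD_eq n x l1.le, ← sigmaD_eq n y l2.le, h.sig, h'.sig]
  have key : ∀ i ≤ w, x i = y i := by
    by_cases he : Even n
    · have e1 := etaLen_eq u w x
      have e2 := etaLen_eq u w y
      have e3 := h.len hn
      have e4 := h'.len hn
      have a1 := h.min.2 he y (by rw [h.sig, h'.sig]) (by omega)
      have a2 := h'.min.2 he x (by rw [h.sig, h'.sig]) (by omega)
      exact uniq_even hn he w x y (fun i _ => h.digit i) (fun i _ => absLex_antisymm a1 a2 i) hs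
    · exact uniq_odd hn he w x y (fun i _ => h.digit i) (fun i _ => h'.digit i) hs
  ext i
  rcases le_or_gt i w with hi | hi
  · exact key i hi
  · rw [zero_of_kIdx (l1.trans hi), zero_of_kIdx (l2.trans hi)]

theorem OP_exists {n : ℕ} (hn : 2 ≤ n) (u w : ℕ) (hw : 1 ≤ w) (v : ℤ) (hv : v ≠ 0)
    (hb : |v| ≤ (n : ℤ) ^ (w - 1)) : ∃ x, OP n u w v x := by
  set M := max u w with hM
  obtain ⟨f, hf1, hf2⟩ := exists_isOpt hn M v
  obtain ⟨x, hx1, hx2⟩ := exists_finsupp M f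
  have hsig : sigmaD n x = v := by rw [sigmaD_eq n x hx2, sumD_congr hx1, hf1]
  have hne : x ≠ 0 := by
    rintro rfl
    exact hv (by rw [← hsig]; simp [sigmaD])
  have hlt : kIdx x < w := by
    have : kIdx x ≤ w - 1 := by
      apply kIdx_le
      intro i hi
      rcases le_or_gt i M with h | h
      · rw [hx1 i h]
        exact opt_supp hn (w - 1) M f hf2.1 (by rw [hf1]; exact hb) i hi h
      · exact zero_of_kIdx (by omega)
    omega
  have hdig : ∀ i < M, |x i| ≤ ((n / 2 : ℕ) : ℤ) := by
    intro i hi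
    rw [hx1 i hi.le]
    exact hf2.box hn i hi
  have hl : l1D x = DD n M v := by
    rw [l1D_eq x hx2, l1F_congr hx1]
    have h1 := hf2.1
    have h2 := DD_le_l1F hn M f
    rw [hf1] at h1 h2
    omega
  have hDM : ∀ M', M ≤ M' → DD n M' v = DD n M v := fun M' h =>
    DD_stable hn M M' v (hb.trans (pow_mono' hn (by omega))) h
  have e1 := etaLen_eq u w x
  have hy : ∀ y : ℕ →₀ ℤ, sigmaD n y = v → etaLen u w x ≤ etaLen u w y ∧
      (etaLen u w y = etaLen u w x → kIdx y ≤ M ∧ l1D y = DD n M v) := by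
    intro y hy
    have e2 := etaLen_eq u w y
    have h1 := DD_le_l1F hn (max (kIdx y) M) y
    rw [← sigmaD_eq n y (le_max_left _ _), ← l1D_eq y (le_max_left _ _), hy,
      hDM _ (le_max_right _ _)] at h1
    omega
  refine ⟨x, hne, hsig, ⟨rfl, ?_, ?_, ?_⟩, ⟨?_, ?_⟩, hlt⟩
  · intro i hi
    exact hdig i (by omega)
  · intro h
    exact hdig _ h
  · intro h
    omega
  · intro y h
    exact (hy y (by rw [h, hsig])).1
  · intro _ y h h'
    obtain ⟨h3, h4⟩ := (hy y (by rw [h, hsig])).2 h'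
    have := hf2.2 y (by rw [← sigmaD_eq n y h3, h, hsig, hf1])
      (by rw [← l1D_eq y h3, h4, hf1])
    rcases this with g | ⟨i, hi, hj, hl⟩
    · left
      intro i
      rcases le_or_gt i M with hi | hi
      · rw [hx1 i hi]; exact g i hi
      · rw [zero_of_kIdx (lt_of_le_of_lt hx2 hi), zero_of_kIdx (lt_of_le_of_lt h3 hi)]
    · right
      refine ⟨i, ?_, ?_⟩
      · intro j hj'
        rw [hx1 j (by omega)]; exact hj j hj'
      · rw [hx1 i hi]; exact hl

theorem mem_OnLang {n : ℕ} {wd : List Letter} :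
    wd ∈ OnLang n ↔ ∃ u w v x, OP n u w v x ∧ wd = eta1Word u w x := by
  constructor
  · rintro ⟨u, w, x, h1, h2, h3, h4, h5⟩
    exact ⟨u, w, _, x, ⟨h1, rfl, h2, h3, h4⟩, h5⟩
  · rintro ⟨u, w, v, x, h, h5⟩
    exact ⟨u, w, x, h.ne, h.box, h.min, h.lt, h5⟩

theorem OP.length {n u w : ℕ} (hn : 2 ≤ n) {v : ℤ} {x : ℕ →₀ ℤ} (h : OP n u w v x) :
    (eta1Word u w x).length = u + w + Dinf n v := by
  rw [eta1_length u w x h.lt.le, h.len hn]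

theorem OP.word_inj {n u w u' w' : ℕ} (hn : 2 ≤ n) {v v' : ℤ} {x x' : ℕ →₀ ℤ}
    (h : OP n u w v x) (h' : OP n u' w' v' x') (e : eta1Word u w x = eta1Word u' w' x') :
    u = u' ∧ w = w' ∧ v = v' := by
  have c := eta1_count u w x h.lt.le
  rw [e, eta1_count u' w' x' h'.lt.le] at c
  subst c
  have g := eta1_eval n u' w x h.lt.le
  rw [e, eta1_eval n u' w' x' h'.lt.le, h.sig, h'.sig] at g
  obtain ⟨g1, g2⟩ := nf_eq hn g
  refine ⟨rfl, by omega, ?_⟩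
  have : (n : ℤ) ^ u' ≠ 0 := pow_ne_zero _ (by omega)
  exact (mul_right_cancel₀ this g2).symm

theorem ncard_le_of_rel {α β : Type*} {s : Set α} {t : Set β} (ht : t.Finite)
    (R : α → β → Prop) (h1 : ∀ a ∈ s, ∃ b ∈ t, R a b)
    (h2 : ∀ a ∈ s, ∀ a' ∈ s, ∀ b, R a b → R a' b → a = a') : s.ncard ≤ t.ncard := by
  rcases s.eq_empty_or_nonempty with rfl | ⟨a0, ha0⟩
  · simp
  have : Nonempty β := ⟨(h1 a0 ha0).choose⟩
  choose! F hF1 hF2 using h1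
  apply Set.ncard_le_ncard_of_injOn F hF1 _ ht
  intro a ha a' ha' e
  exact h2 a ha a' ha' (F a) (hF2 a ha) (by rw [e]; exact hF2 a' ha')

/-! ### first inequality -/

def E2 (n u w : ℕ) (v : ℤ) (p : ℕ) (V : ℤ) (q : ℕ) : Prop :=
  ∃ (j : ℕ) (v0 s : ℤ), 1 ≤ j ∧ j < w ∧ v = (n : ℤ) ^ j * v0 ∧
    ((s = 1 ∧ 0 ≤ v0) ∨ (s = -1 ∧ v0 ≤ 0)) ∧ |v0| < (n : ℤ) ^ w ∧ V = v0 + s * (n : ℤ) ^ w ∧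
    ((j < u ∧ p = u + w - j - 1 ∧ q = j) ∨ (j = u ∧ p = w + u - 1 ∧ q = 0))

def EE (n u w : ℕ) (v : ℤ) (g : BS n) : Prop :=
  ∃ p V q, Red n p V q ∧ g = nf n p V q ∧ ((p = u ∧ V = v ∧ q = w) ∨ E2 n u w v p V q)

theorem EE_exists {n : ℕ} (hn : 2 ≤ n) (u w : ℕ) (v : ℤ) (hv : v ≠ 0) (hb : |v| < (n : ℤ) ^ w) :
    ∃ g, EE n u w v g ∧ wordLength n g = u + w + Dinf n v := by
  have hp : ∀ m : ℕ, (0 : ℤ) < (n : ℤ) ^ m := fun m => by positivity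
  have hj : ∃ j ≤ u, (n : ℤ) ^ j ∣ v ∧ (j = u ∨ ¬ (n : ℤ) ^ (j + 1) ∣ v) := by
    classical
    have h0 : (n : ℤ) ^ 0 ∣ v := by simp
    refine ⟨Nat.findGreatest (fun j => (n : ℤ) ^ j ∣ v) u, Nat.findGreatest_le u,
      Nat.findGreatest_spec (P := fun j => (n : ℤ) ^ j ∣ v) (Nat.zero_le u) h0, ?_⟩
    by_cases h : Nat.findGreatest (fun j => (n : ℤ) ^ j ∣ v) u = u
    · exact Or.inl h
    · right
      have := Nat.findGreatest_le (P := fun j => (n : ℤ) ^ j ∣ v) u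
      exact Nat.findGreatest_is_greatest (P := fun j => (n : ℤ) ^ j ∣ v) (n := u)
        (Nat.lt_succ_self _) (by omega)
  obtain ⟨j, hju, ⟨v0, hv0⟩, hmax⟩ := hj
  have hv0ne : v0 ≠ 0 := by rintro rfl; simp at hv0; exact hv hv0
  have habs : |v| = (n : ℤ) ^ j * |v0| := by rw [hv0, abs_mul, abs_of_pos (hp j)]
  have h1 : 1 ≤ |v0| := Int.one_le_abs hv0ne
  have hjw : j < w := by
    by_contra hc
    have := pow_mono' hn (show w ≤ j by omega)
    nlinarith [hp j]
  have hD := Dinf_eq hn w v hb.le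
  by_cases hj0 : j = 0
  · subst hj0
    have hr : Red n u v w := by
      rcases hmax with h | h
      · exact Or.inl h.symm
      · exact Or.inr (Or.inr (by simpa using h))
    refine ⟨nf n u v w, ⟨u, v, w, hr, rfl, Or.inl ⟨rfl, rfl, rfl⟩⟩, ?_⟩
    rw [len_eq hn hr (d := Dinf n v)]
    · ring
    · intro M _ hM
      rw [DD_stable hn w M v hb.le hM, hD]
  · have hb0 : |v0| < (n : ℤ) ^ (w - j) := by
      have e : (n : ℤ) ^ w = (n : ℤ) ^ j * (n : ℤ) ^ (w - j) := by
        rw [← pow_add]; congr 1; omega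
      rw [habs, e] at hb
      exact lt_of_mul_lt_mul_left hb (hp j).le
    have hbw : |v0| < (n : ℤ) ^ w := lt_of_lt_of_le hb0 (pow_mono' hn (by omega))
    obtain ⟨s, hs⟩ : ∃ s : ℤ, (s = 1 ∧ 0 ≤ v0) ∨ (s = -1 ∧ v0 ≤ 0) := by
      rcases le_total 0 v0 with h | h
      · exact ⟨1, Or.inl ⟨rfl, h⟩⟩
      · exact ⟨-1, Or.inr ⟨rfl, h⟩⟩
    have hDD : ∀ M, w ≤ M → DD n M (v0 + s * (n : ℤ) ^ w) = Dinf n v + 1 := by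
      intro M hM
      rw [DD_top hn (w - j) M w v0 s hs hb0.le (by omega) hM, ← hD, hv0]
      congr 1
      have := DD_shift_pow hn j (w - j) v0
      rw [show w - j + j = w by omega] at this
      exact this.symm
    rcases hju.lt_or_eq with hlt | heq
    · have hnd : ¬ (n : ℤ) ∣ v0 := by
        rcases hmax with h | h
        · omega
        · rintro ⟨c, hc⟩
          exact h ⟨c, by rw [hv0, hc]; ring⟩
      have hr : Red n (u + w - j - 1) (v0 + s * (n : ℤ) ^ w) j := by
        right; right
        intro h
        apply hnd
        exact (Int.dvd_add_left (Dvd.dvd.mul_left (dvd_pow_self _ (by omega)) s)).mp h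
      refine ⟨_, ⟨_, _, _, hr, rfl, Or.inr ⟨j, v0, s, by omega, hjw, hv0, hs, hbw, rfl,
        Or.inl ⟨hlt, rfl, rfl⟩⟩⟩, ?_⟩
      rw [len_eq hn hr (d := Dinf n v + 1) (fun M h2 _ => hDD M (by omega))]
      omega
    · have hr : Red n (w + u - 1) (v0 + s * (n : ℤ) ^ w) 0 := Or.inr (Or.inl rfl)
      refine ⟨_, ⟨_, _, _, hr, rfl, Or.inr ⟨j, v0, s, by omega, hjw, hv0, hs, hbw, rfl,
        Or.inr ⟨heq, rfl, rfl⟩⟩⟩, ?_⟩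
      rw [len_eq hn hr (d := Dinf n v + 1) (fun M h2 _ => hDD M (by omega))]
      omega

theorem top_abs {n w : ℕ} {v0 s : ℤ} (hs : (s = 1 ∧ 0 ≤ v0) ∨ (s = -1 ∧ v0 ≤ 0)) :
    |v0 + s * (n : ℤ) ^ w| = |v0| + (n : ℤ) ^ w := by
  have hp : (0 : ℤ) ≤ (n : ℤ) ^ w := by positivity
  rcases hs with ⟨rfl, h⟩ | ⟨rfl, h⟩
  · rw [abs_of_nonneg h, abs_of_nonneg (by omega)]; ring
  · rw [abs_of_nonpos h, abs_of_nonpos (by omega)]; ring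

theorem EE_inj {n : ℕ} (hn : 2 ≤ n) {u w u' w' : ℕ} {v v' : ℤ} {g : BS n}
    (hb : |v| < (n : ℤ) ^ w) (hb' : |v'| < (n : ℤ) ^ w')
    (h : EE n u w v g) (h' : EE n u' w' v' g) : u = u' ∧ w = w' ∧ v = v' := by
  obtain ⟨p, V, q, hr, e, h⟩ := h
  obtain ⟨p', V', q', hr', e', h'⟩ := h'
  obtain ⟨rfl, rfl, rfl⟩ := nf_red_inj hn hr hr' (e.symm.trans e')
  have hp : ∀ m : ℕ, (0 : ℤ) < (n : ℤ) ^ m := fun m => by positivity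
  have far : ∀ {u w : ℕ} {v : ℤ}, E2 n u w v p V q →
      (n : ℤ) ^ w ≤ |V| ∧ |V| < (n : ℤ) ^ (w + 1) ∧ q < w := by
    rintro u w v ⟨j, v0, s, j1, j2, _, hs, hv, rfl, hq⟩
    rw [top_abs hs]
    refine ⟨by linarith [abs_nonneg v0], ?_, by omega⟩
    have : (2 : ℤ) ≤ n := by exact_mod_cast hn
    rw [pow_succ]
    nlinarith [hp w]
  have mix : ∀ {u w w' : ℕ} {v : ℤ}, E2 n u w v p V q → |V| < (n : ℤ) ^ w' → q = w' → False := by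
    intro u w w' v h1 h2 h3
    obtain ⟨a, _, b⟩ := far h1
    have := pow_mono' hn (show w' ≤ w by omega)
    omega
  rcases h with ⟨rfl, rfl, rfl⟩ | h
  · rcases h' with ⟨h1, h2, h3⟩ | h'
    · exact ⟨h1, h3, h2⟩
    · exact (mix h' hb rfl).elim
  · rcases h' with ⟨rfl, rfl, rfl⟩ | h'
    · exact (mix h hb' rfl).elim
    · obtain ⟨a1, a2, _⟩ := far h
      obtain ⟨b1, b2, _⟩ := far h'
      obtain rfl : w = w' := by
        rcases lt_trichotomy w w' with hh | hh | hh
        · have := pow_mono' hn (show w + 1 ≤ w' by omega)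
          omega
        · exact hh
        · have := pow_mono' hn (show w' + 1 ≤ w by omega)
          omega
      obtain ⟨j, v0, s, j1, j2, hv, hs, hv0, hV, hq⟩ := h
      obtain ⟨j', v0', s', j1', j2', hv', hs', hv0', hV', hq'⟩ := h'
      have hpw := hp w
      have hvv : v0 = v0' := by
        rcases hs with ⟨rfl, c⟩ | ⟨rfl, c⟩ <;> rcases hs' with ⟨rfl, c'⟩ | ⟨rfl, c'⟩ <;> omega
      subst hvv
      have hu : u = u' ∧ j = j' := by omega
      obtain ⟨rfl, rfl⟩ := hu
      exact ⟨rfl, rfl, hv.trans hv'.symm⟩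

theorem first_ineq {n : ℕ} (hn : 2 ≤ n) (N : ℕ) :
    (OnLang n ∩ {wd : List Letter | wd.length = N}).ncard ≤ (bsSphere n N).ncard := by
  apply ncard_le_of_rel (sphere_finite hn N) (fun wd g => ∃ u w v x, OP n u w v x ∧
    wd = eta1Word u w x ∧ EE n u w v g)
  · rintro wd ⟨h1, h2⟩
    obtain ⟨u, w, v, x, h, rfl⟩ := mem_OnLang.mp h1
    obtain ⟨g, hg, hl⟩ := EE_exists hn u w v (h.vne hn) (h.bound hn)
    refine ⟨g, ?_, u, w, v, x, h, rfl, hg⟩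
    have h2 : (eta1Word u w x).length = N := h2
    rw [h.length hn] at h2
    exact hl.trans h2
  · rintro _ _ _ _ g ⟨u, w, v, x, h, rfl, hg⟩ ⟨u', w', v', x', h', rfl, hg'⟩
    obtain ⟨rfl, rfl, rfl⟩ := EE_inj hn (h.bound hn) (h'.bound hn) hg hg'
    rw [h.uniq hn h']

/-! ### second inequality -/

theorem classify {n : ℕ} (hn : 2 ≤ n) {N u w : ℕ} {v : ℤ} (hr : Red n u v w) (huw : u ≤ w)
    (hN : wordLength n (nf n u v w) = N) :
    (|v| ≤ (n : ℤ) ^ w ∧ N = Dinf n v + u + w) ∨ ∃ M, w ≤ M ∧ DD n M v + 2 * M + u = N + w ∧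
      (n : ℤ) ^ M < n * |v| ∧ |v| < (n : ℤ) ^ (M + 2) := by
  have hn' : (2 : ℤ) ≤ n := by exact_mod_cast hn
  by_cases hv : |v| ≤ (n : ℤ) ^ w
  · left
    refine ⟨hv, ?_⟩
    rw [← hN]
    apply len_eq hn hr
    intro M _ hM
    rw [DD_stable hn w M v hv hM, Dinf_eq hn w v hv]
  · right
    have hle : ∀ M, w ≤ M → N + w ≤ DD n M v + 2 * M + u := by
      intro M hM
      have := len_le hn v (huw.trans hM) hM
      omega
    obtain ⟨M0, _, h1, h2⟩ := len_ge hn hr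
    classical
    let P : ℕ → Prop := fun M => w ≤ M ∧ DD n M v + 2 * M + u ≤ N + w
    have hP0 : P M0 := ⟨h1, by omega⟩
    have hPM : P (Nat.findGreatest P (N + w)) :=
      Nat.findGreatest_spec (P := P) (show M0 ≤ N + w by omega) hP0
    have hPM' : ¬ P (Nat.findGreatest P (N + w) + 1) := by
      by_cases hc : Nat.findGreatest P (N + w) + 1 ≤ N + w
      · exact Nat.findGreatest_is_greatest (P := P) (n := N + w) (Nat.lt_succ_self _) hc
      · rintro ⟨_, h⟩
        omega
    generalize Nat.findGreatest P (N + w) = M at hPM hPM'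
    obtain ⟨a1, a2⟩ := hPM
    refine ⟨M, a1, le_antisymm a2 (hle M a1), ?_, ?_⟩
    · rcases a1.lt_or_eq with hlt | rfl
      · by_contra hc
        obtain ⟨M, rfl⟩ : ∃ M', M = M' + 1 := ⟨M - 1, by omega⟩
        have hb : |v| ≤ (n : ℤ) ^ M := by
          rw [pow_succ, mul_comm] at hc
          exact le_of_mul_le_mul_left (not_lt.mp hc) (by omega)
        have e := DD_stable hn M (M + 1) v hb (by omega)
        have := hle M (by omega)
        omega
      · have : 0 ≤ |v| := abs_nonneg v
        nlinarith
    · by_contra hc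
      have := DD_gap hn M v (not_lt.mp hc)
      exact hPM' ⟨by omega, by omega⟩

def OO (n N : ℕ) : Set (List Letter) := OnLang n ∩ {wd : List Letter | wd.length = N}

theorem OO_finite (n N : ℕ) : (OO n N).Finite := (words_finite N).subset Set.inter_subset_right

theorem OO_target {n : ℕ} (hn : 2 ≤ n) {N u w : ℕ} {v : ℤ} (hv : v ≠ 0) (hw : 1 ≤ w)
    (hb : |v| ≤ (n : ℤ) ^ (w - 1)) (hN : u + w + Dinf n v = N) :
    ∃ wd ∈ OO n N, ∃ x, OP n u w v x ∧ wd = eta1Word u w x := by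
  obtain ⟨x, hx⟩ := OP_exists hn u w hw v hv hb
  exact ⟨_, ⟨mem_OnLang.mpr ⟨u, w, v, x, hx, rfl⟩, (hx.length hn).trans hN⟩, x, hx, rfl⟩

theorem OO_pos {n : ℕ} (hn : 2 ≤ n) (N : ℕ) : 1 ≤ (OO n (N + 3)).ncard := by
  have h1 : Dinf n 1 = 1 := by
    have h2 := Dinf_le hn 0 1
    rw [DD_zero] at h2
    have h3 : 1 ≤ Dinf n 1 := DD_pos hn _ 1 one_ne_zero
    simp at h2
    omega
  obtain ⟨wd, hwd, _⟩ := OO_target hn (N := N + 3) (u := 0) (w := N + 2) (v := 1) one_ne_zero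
    (by omega) (by rw [abs_one]; exact one_le_pow₀ (by omega)) (by omega)
  exact (Set.ncard_pos (OO_finite n _)).mpr ⟨wd, hwd⟩

def dStar (n N u : ℕ) (v : ℤ) (w : ℕ) : Prop :=
  v ≠ 0 ∧ |v| ≤ (n : ℤ) ^ w ∧ N = Dinf n v + u + w

def dM (n N i u : ℕ) (v : ℤ) (w : ℕ) : Prop :=
  v ≠ 0 ∧ ∃ M, w ≤ M ∧ DD n M v + 2 * M + u = N + w ∧
      (n : ℤ) ^ M < n * |v| ∧ |v| < (n : ℤ) ^ (M + 2) ∧ M % 3 = i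

theorem dStar_card {n : ℕ} (hn : 2 ≤ n) (N : ℕ) :
    (bsSphere n N ∩ {g : BS n | ∃ u v w, g = nf n u v w ∧ dStar n N u v w}).ncard ≤ (OO n (N + 3)).ncard := by
  apply ncard_le_of_rel (OO_finite n _) (fun g wd => ∃ u v w w' x, g = nf n u v w ∧
    dStar n N u v w ∧ OP n u w' v x ∧ wd = eta1Word u w' x)
  · rintro g ⟨_, u, v, w, hg, hd⟩
    obtain ⟨h1, h2, h3⟩ := id hd
    obtain ⟨wd, hwd, x, hx, e⟩ := OO_target hn (N := N + 3) (u := u) (w := w + 3) h1 (by omega)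
      (h2.trans (pow_mono' hn (by omega))) (by omega)
    exact ⟨wd, hwd, u, v, w, w + 3, x, hg, hd, hx, e⟩
  · rintro _ _ _ _ wd ⟨u, v, w, w', x, rfl, ⟨_, _, h⟩, hx, rfl⟩
      ⟨p, V, W, W', y, rfl, ⟨_, _, h'⟩, hy, e⟩
    obtain ⟨rfl, rfl, rfl⟩ := hx.word_inj hn hy e
    obtain rfl : w = W := by omega
    rfl

theorem dM_card {n : ℕ} (hn : 2 ≤ n) (N i : ℕ) :
    (bsSphere n N ∩ {g : BS n | ∃ u v w, g = nf n u v w ∧ dM n N i u v w}).ncard ≤ (OO n (N + 3)).ncard := by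
  apply ncard_le_of_rel (OO_finite n _) (fun g wd => ∃ u v w w' x, g = nf n u v w ∧
    dM n N i u v w ∧ OP n u w' v x ∧ wd = eta1Word u w' x)
  · rintro g ⟨_, u, v, w, hg, hd⟩
    obtain ⟨h1, M, h2, h3, h4, h5, h6⟩ := id hd
    have h7 := Dinf_le hn M v
    obtain ⟨wd, hwd, x, hx, e⟩ := OO_target hn (N := N + 3) (u := u) (w := N + 3 - u - Dinf n v) h1
      (by omega) (h5.le.trans (pow_mono' hn (by omega))) (by omega)
    exact ⟨wd, hwd, u, v, w, _, x, hg, hd, hx, e⟩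
  · rintro _ _ _ _ wd ⟨u, v, w, w', x, rfl, ⟨_, M, h2, h3, h4, h5, h6⟩, hx, rfl⟩
      ⟨p, V, W, W', y, rfl, ⟨_, M', h2', h3', h4', h5', h6'⟩, hy, e⟩
    obtain ⟨rfl, rfl, rfl⟩ := hx.word_inj hn hy e
    have hn' : (0 : ℤ) < n := by exact_mod_cast (by omega : 0 < n)
    have key : ∀ {M M' : ℕ}, |v| < (n : ℤ) ^ (M + 2) → (n : ℤ) ^ M' < n * |v| → M' < M + 3 := by
      intro M M' h h'
      by_contra hc
      have h1 := pow_mono' hn (show M + 3 ≤ M' by omega)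
      have h2 : (n : ℤ) ^ (M + 3) = n * (n : ℤ) ^ (M + 2) := by ring
      nlinarith
    have k1 := key h5 h4'
    have k2 := key h5' h4
    obtain rfl : M = M' := by omega
    obtain rfl : w = W := by omega
    rfl

theorem second_ineq {n : ℕ} (hn : 2 ≤ n) (N : ℕ) :
    (bsSphere n N).ncard ≤ 20 * (OO n (N + 3)).ncard := by
  set S := bsSphere n N with hS
  have hSf : S.Finite := sphere_finite hn N
  let CS : Set (BS n) := S ∩ {g : BS n | ∃ u v w, g = nf n u v w ∧ dStar n N u v w}
  let CM : ℕ → Set (BS n) := fun i => S ∩ {g : BS n | ∃ u v w, g = nf n u v w ∧ dM n N i u v w}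
  let A : Set (BS n) := {g | g ∈ S ∧ ∃ u v w, Red n u v w ∧ u ≤ w ∧ g = nf n u v w}
  have hAf : A.Finite := hSf.subset fun g hg => hg.1
  have hinv : ∀ g, g ∈ S → g⁻¹ ∈ S := fun g hg => (len_inv hn g).trans hg
  have hsub : S ⊆ A ∪ (fun g => g⁻¹) '' A := by
    intro g hg
    obtain ⟨u, v, w, hr, e⟩ := exists_nf hn g
    rcases le_total u w with h | h
    · exact Or.inl ⟨hg, u, v, w, hr, h, e⟩
    · refine Or.inr ⟨g⁻¹, ⟨hinv g hg, w, -v, u, ?_, h, by rw [e, nf_inv]⟩, inv_inv g⟩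
      rcases hr with h | h | h
      · exact Or.inr (Or.inl h)
      · exact Or.inl h
      · exact Or.inr (Or.inr (by rwa [Int.dvd_neg]))
  have h1 : S.ncard ≤ 2 * A.ncard := by
    have a := Set.ncard_le_ncard hsub (hAf.union (hAf.image _))
    have b := Set.ncard_union_le A ((fun g => g⁻¹) '' A)
    have c := Set.ncard_image_le (f := fun g : BS n => g⁻¹) hAf
    omega
  have hA : A ⊆ {nf n 0 0 N} ∪ (CS ∪ (CM 0 ∪ (CM 1 ∪ CM 2))) := by
    rintro g ⟨hg, u, v, w, hr, huw, rfl⟩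
    by_cases hv : v = 0
    · left
      subst hv
      have hu : u = 0 := by
        rcases hr with h | h | h
        · exact h
        · omega
        · exact (h (dvd_zero _)).elim
      subst hu
      have hl := len_eq hn hr (d := 0) (fun M _ _ => by
        have := DD_le_abs hn M 0
        simpa using this)
      have : wordLength n (nf n 0 0 w) = N := hg
      obtain rfl : w = N := by omega
      rfl
    · right
      rcases classify hn hr huw hg with ⟨h1, h2⟩ | ⟨M, h1, h2, h3, h4⟩
      · exact Or.inl ⟨hg, u, v, w, rfl, hv, h1, h2⟩
      · right
        have key : ∀ i, M % 3 = i → nf n u v w ∈ CM i := fun i hi =>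
          ⟨hg, u, v, w, rfl, hv, M, h1, h2, h3, h4, hi⟩
        have : M % 3 = 0 ∨ M % 3 = 1 ∨ M % 3 = 2 := by omega
        rcases this with h | h | h
        · exact Or.inl (key 0 h)
        · exact Or.inr (Or.inl (key 1 h))
        · exact Or.inr (Or.inr (key 2 h))
  have fS : CS.Finite := hSf.subset Set.inter_subset_left
  have fM : ∀ i, (CM i).Finite := fun i => hSf.subset Set.inter_subset_left
  have h2 := Set.ncard_le_ncard hA
    ((Set.finite_singleton _).union (fS.union ((fM 0).union ((fM 1).union (fM 2)))))
  have u1 := Set.ncard_union_le {nf n 0 0 N} (CS ∪ (CM 0 ∪ (CM 1 ∪ CM 2)))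
  have u2 := Set.ncard_union_le CS (CM 0 ∪ (CM 1 ∪ CM 2))
  have u3 := Set.ncard_union_le (CM 0) (CM 1 ∪ CM 2)
  have u4 := Set.ncard_union_le (CM 1) (CM 2)
  rw [Set.ncard_singleton] at u1
  have c1 : CS.ncard ≤ _ := dStar_card hn N
  have c2 : ∀ i, (CM i).ncard ≤ _ := dM_card hn N
  have c20 := c2 0
  have c21 := c2 1
  have c22 := c2 2
  have hpos := OO_pos hn N
  omega

/-- For every `n ≥ 2` and every `N`, `|O_n(N)| ≤ |S_n(N)| ≤ 20·|O_n(N+3)|`. -/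
theorem sphere_vs_shape1 (n : ℕ) (hn : 2 ≤ n) (N : ℕ) :
    (OnLang n ∩ {wd : List Letter | wd.length = N}).ncard ≤ (bsSphere n N).ncard ∧
    (bsSphere n N).ncard ≤ 20 * (OnLang n ∩ {wd : List Letter | wd.length = N + 3}).ncard := by
  exact ⟨first_ineq hn N, second_ineq hn N⟩
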